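/- arXiv:0809.5267 — 7 statements merged into one kernel-verified Lean document; each statement's English description precedes it below -/
import Mathlib

section
/- Let (R, m) be a local ring (a commutative ring, not necessarily Noetherian, with a unique maximal ideal m) such that m is finitely generated. Then the m-adic completion R̂ of R (the inverse limit of the rings R/m^n) is a Noetherian local ring whose maximal ideal is the extended ideal m·R̂, and for every n ≥ 1 the natural map R/m^n → R̂/m^n·R̂ is an isomorphism. -/
/-!
STATEMENT 0: For a local ring `(R, m)` (not necessarily Noetherian) with `m` finitely
generated, the `m`-adic completion `R̂` (realized in Mathlib as `AdicCompletion m R`,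
the inverse limit of the `R/m^n`) is a Noetherian local ring whose maximal ideal is
`m·R̂`, and for every `n ≥ 1` the natural map `R/m^n → R̂/m^n·R̂` is an isomorphism.
-/

universe u

open MvPolynomial in
/-- Multiplying by a homogeneous polynomial of degree `e` shifts homogeneous components by `e`. -/
theorem MvPolynomial.homogeneousComponent_mul_of_isHomogeneous {σ A : Type*} [CommRing A]
    {F : MvPolynomial σ A} {e : ℕ} (hF : F.IsHomogeneous e) (G : MvPolynomial σ A) (d : ℕ) :
    homogeneousComponent d (G * F) =
      (if e ≤ d then homogeneousComponent (d - e) G else 0) * F := by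
  let := MvPolynomial.gradedAlgebra (σ := σ) (R := A)
  have key (n : ℕ) (p : MvPolynomial σ A) : homogeneousComponent n p =
      (DirectSum.decompose (homogeneousSubmodule σ A) p n : MvPolynomial σ A) :=
    (decomposition.decompose'_apply p n).symm
  rw [key]
  split_ifs with h
  · rw [DirectSum.coe_decompose_mul_of_right_mem_of_le _ hF h, key]
  · rw [DirectSum.coe_decompose_mul_of_right_mem_of_not_le _ hF h, zero_mul]

/-- A homogeneous polynomial of degree `d` with coefficients in `I` takes values in `I ^ (d + 1)`
at points with coordinates in `I`. -/
theorem MvPolynomial.IsHomogeneous.eval_mem_pow_succ {σ A : Type*} [CommRing A] {I : Ideal A}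
    {F : MvPolynomial σ A} {d : ℕ} (hF : F.IsHomogeneous d) (hI : ∀ m, F.coeff m ∈ I)
    {x : σ → A} (hx : Ideal.span (Set.range x) = I) : F.eval x ∈ I ^ (d + 1) := by
  rw [F.as_sum, map_sum]
  refine Ideal.sum_mem _ fun m hm ↦ ?_
  have hm' : (MvPolynomial.monomial m (1 : A)).eval x ∈ I ^ d := by
    rw [← hx, Ideal.mem_span_pow_iff_exists_isHomogeneous]
    refine ⟨_, MvPolynomial.isHomogeneous_monomial 1 ?_, rfl⟩
    rw [Finsupp.degree_eq_weight_one]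
    exact hF (MvPolynomial.mem_support_iff.mp hm)
  rw [← mul_one (F.coeff m), ← MvPolynomial.C_mul_monomial, map_mul, MvPolynomial.eval_C,
    pow_succ']
  exact Ideal.mul_mem_mul (hI m) hm'

open MvPolynomial in
/-- If `I` is finitely generated and `A ⧸ I` is Noetherian, every ideal `J` of `A` contains finitely
many elements whose `A`-linear combinations approximate the elements of `J` one step at a time along
the `I`-adic filtration, with coefficients tending to zero. -/
theorem Ideal.exists_finset_adic_approximation {A : Type*} [CommRing A] {I : Ideal A} (hI : I.FG)
    [IsNoetherianRing (A ⧸ I)] (J : Ideal A) :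
    ∃ (n : ℕ) (f : Fin n → A) (D : ℕ), (∀ i, f i ∈ J) ∧ ∀ d, ∀ y ∈ J ⊓ I ^ d,
      ∃ a : Fin n → A, (∀ i, a i ∈ I ^ (d - D)) ∧ y - ∑ i, a i * f i ∈ J ⊓ I ^ (d + 1) := by
  obtain ⟨r, x, hx⟩ := Submodule.fg_iff_exists_fin_generating_family.mp hI
  replace hx : Ideal.span (Set.range x) = I := hx
  let q := MvPolynomial.map (σ := Fin r) (Ideal.Quotient.mk I)
  let T : Set (MvPolynomial (Fin r) (A ⧸ I)) :=
    {t | ∃ (d : ℕ) (F : MvPolynomial (Fin r) A) (f : A), F.IsHomogeneous d ∧ f ∈ J ∧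
      f - F.eval x ∈ I ^ (d + 1) ∧ q F = t}
  obtain ⟨s, hsT, hs⟩ := (Submodule.fg_span_iff_fg_span_finset_subset T).mp
    (IsNoetherian.noetherian (Submodule.span (MvPolynomial (Fin r) (A ⧸ I)) T))
  let e := s.equivFin.symm
  have hT (i : Fin s.card) := hsT (e i).2
  choose δ F f hF hf hfF hFt using hT
  refine ⟨s.card, f, ∑ i, δ i, hf, fun d y hy ↦ ?_⟩
  obtain ⟨P, hP, rfl⟩ :=
    (Ideal.mem_span_pow_iff_exists_isHomogeneous x y).mp (by rw [hx]; exact hy.2)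
  have hPs : q P ∈ Submodule.span (MvPolynomial (Fin r) (A ⧸ I))
      (Set.range fun i ↦ (e i : MvPolynomial (Fin r) (A ⧸ I))) := by
    have : (Set.range fun i ↦ (e i : MvPolynomial (Fin r) (A ⧸ I))) = s := by
      rw [← Function.comp_def, e.surjective.range_comp]
      simp
    rw [this, ← hs]
    exact Submodule.subset_span ⟨d, P, _, hP, hy.1, by simp, rfl⟩
  obtain ⟨c, hc⟩ := (Submodule.mem_span_range_iff_exists_fun _).mp hPs
  choose G hG using fun i ↦ MvPolynomial.map_surjective (σ := Fin r) (Ideal.Quotient.mk I)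
    Ideal.Quotient.mk_surjective (c i)
  let Q := P - ∑ i, G i * F i
  have hQ (m) : Q.coeff m ∈ I := by
    have : q Q = 0 := by
      have hG' (i) : q (G i) = c i := hG i
      simp [Q, ← hc, hFt, hG']
    rw [← Ideal.Quotient.eq_zero_iff_mem, ← MvPolynomial.coeff_map]
    change (q Q).coeff m = 0
    rw [this, MvPolynomial.coeff_zero]
  let H (i) : MvPolynomial (Fin r) A :=
    if δ i ≤ d then homogeneousComponent (d - δ i) (G i) else 0
  have hH (i) : (H i).eval x ∈ I ^ (d - δ i) ∧
      (H i).eval x * (f i - (F i).eval x) ∈ I ^ (d + 1) := by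
    by_cases h : δ i ≤ d
    · have h1 : (H i).eval x ∈ I ^ (d - δ i) := by
        rw [← hx, Ideal.mem_span_pow_iff_exists_isHomogeneous]
        refine ⟨_, ?_, rfl⟩
        simp only [H, h, if_true]
        exact homogeneousComponent_isHomogeneous _ _
      refine ⟨h1, ?_⟩
      rw [show d + 1 = (d - δ i) + (δ i + 1) by omega, pow_add]
      exact Ideal.mul_mem_mul h1 (hfF i)
    · simp [H, h]
  refine ⟨fun i ↦ (H i).eval x, fun i ↦ ?_, ?_, ?_⟩
  · exact Ideal.pow_le_pow_right (Nat.sub_le_sub_left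
      (Finset.single_le_sum (f := δ) (fun _ _ ↦ Nat.zero_le _) (Finset.mem_univ i)) d) (hH i).1
  · exact J.sub_mem hy.1 (J.sum_mem fun i _ ↦ J.mul_mem_left _ (hf i))
  · have hQd : homogeneousComponent d Q = P - ∑ i, H i * F i := by
      simp only [Q, H, map_sub, map_sum, homogeneousComponent_eq_self hP,
        homogeneousComponent_mul_of_isHomogeneous (hF _)]
    have hQe : (homogeneousComponent d Q).eval x ∈ I ^ (d + 1) := by
      refine (homogeneousComponent_isHomogeneous d Q).eval_mem_pow_succ (fun m ↦ ?_) hx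
      rw [coeff_homogeneousComponent]
      split_ifs
      exacts [hQ m, I.zero_mem]
    have : P.eval x - ∑ i, (H i).eval x * f i = (homogeneousComponent d Q).eval x -
        ∑ i, (H i).eval x * (f i - (F i).eval x) := by
      simp only [hQd, map_sub, map_sum, map_mul, mul_sub, Finset.sum_sub_distrib]
      ring
    rw [this]
    exact Ideal.sub_mem _ hQe (Ideal.sum_mem _ fun i _ ↦ (hH i).2)

/-- A ring that is complete for the adic topology of a finitely generated ideal `I` is Noetherian
as soon as `A ⧸ I` is. -/
theorem IsAdicComplete.isNoetherianRing_of_quotient {A : Type*} [CommRing A] {I : Ideal A}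
    (hI : I.FG) [IsAdicComplete I A] [IsNoetherianRing (A ⧸ I)] : IsNoetherianRing A := by
  refine (isNoetherianRing_iff_ideal_fg A).mpr fun J ↦ ?_
  obtain ⟨n, f, D, hf, step⟩ := Ideal.exists_finset_adic_approximation hI J
  refine Submodule.fg_iff_exists_fin_generating_family.mpr ⟨n, f, le_antisymm ?_ fun y hy ↦ ?_⟩
  · rw [Submodule.span_le]
    rintro _ ⟨i, rfl⟩
    exact hf i
  choose! a ha hstep using step
  let rem : ℕ → A := fun d ↦ Nat.rec y (fun d z ↦ z - ∑ i, a d z i * f i) d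
  have rem_succ (d) : rem (d + 1) = rem d - ∑ i, a d (rem d) i * f i := rfl
  have rem_mem (d) : rem d ∈ J ⊓ I ^ d := by
    induction d with
    | zero => exact ⟨hy, by simp⟩
    | succ d ih => exact hstep d _ ih
  let c (d : ℕ) (i : Fin n) : A := ∑ k ∈ Finset.range d, a k (rem k) i
  have hc (d) : y - ∑ i, c d i * f i = rem d := by
    induction d with
    | zero => simp [c, rem]
    | succ d ih =>
      rw [rem_succ]
      simp only [c, Finset.sum_range_succ, add_mul, Finset.sum_add_distrib] at ih ⊢
      linear_combination ih
  have hcauchy (i) : ∀ {k l : ℕ}, k ≤ l →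
      c (k + D) i ≡ c (l + D) i [SMOD (I ^ k • ⊤ : Submodule A A)] := by
    intro k l hkl
    rw [SModEq.comm, SModEq.sub_mem, smul_eq_mul, Ideal.mul_top]
    simp only [c]
    rw [Finset.sum_range_sub_sum_range (by omega)]
    refine Ideal.sum_mem _ fun j hj ↦ Ideal.pow_le_pow_right ?_ (ha j _ (rem_mem j) i)
    have := (Finset.mem_filter.mp hj).2
    omega
  choose L hL using fun i ↦ IsPrecomplete.prec' (I := I) (fun k ↦ c (k + D) i) (hcauchy i)
  have hy0 : y - ∑ i, L i * f i = 0 := by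
    refine IsHausdorff.haus' (I := I) _ fun k ↦ ?_
    rw [SModEq.zero, smul_eq_mul, Ideal.mul_top]
    have : y - ∑ i, L i * f i = rem (k + D) + ∑ i, (c (k + D) i - L i) * f i := by
      rw [← hc]
      simp only [sub_mul, Finset.sum_sub_distrib]
      ring
    rw [this]
    refine Ideal.add_mem _ (Ideal.pow_le_pow_right (Nat.le_add_right k D) (rem_mem _).2)
      (Ideal.sum_mem _ fun i _ ↦ Ideal.mul_mem_right _ _ ?_)
    simpa [SModEq.sub_mem] using hL i k
  rw [sub_eq_zero.mp hy0]
  exact Submodule.sum_mem _ fun i _ ↦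
    Submodule.smul_mem _ (L i) (Submodule.subset_span ⟨i, rfl⟩)

/-- For `I` finitely generated, the extension of `I ^ n` to the `I`-adic completion is the kernel of
the projection to `R ⧸ I ^ n`. -/
theorem AdicCompletion.ker_evalₐ_eq_map {R : Type*} [CommRing R] {I : Ideal R} (hI : I.FG) (n : ℕ) :
    RingHom.ker (AdicCompletion.evalₐ I n) =
      (I ^ n).map (algebraMap R (AdicCompletion I R)) := by
  ext x
  have h : (I ^ n • ⊤ : Ideal R) = I ^ n := by simp
  have h1 : x ∈ RingHom.ker (AdicCompletion.evalₐ I n) ↔ x ∈ (AdicCompletion.eval I R n).ker :=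
    map_eq_zero_iff (Ideal.quotientEquivAlgOfEq R h) (AlgEquiv.injective _)
  rw [h1, ← AdicCompletion.pow_smul_top_eq_ker_eval hI]
  simp

/-- For `I` finitely generated, `R ⧸ I ^ n` is the quotient of the `I`-adic completion by the
extension of `I ^ n`. -/
theorem AdicCompletion.bijective_quotientMap_pow {R : Type*} [CommRing R] {I : Ideal R}
    (hI : I.FG) (n : ℕ) :
    Function.Bijective (Ideal.quotientMap ((I ^ n).map (algebraMap R (AdicCompletion I R)))
      (algebraMap R (AdicCompletion I R)) Ideal.le_comap_map) := by
  have hev (r : R) : AdicCompletion.evalₐ I n (algebraMap R (AdicCompletion I R) r) =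
      Ideal.Quotient.mk (I ^ n) r := (AdicCompletion.evalₐ I n).commutes r
  constructor
  · refine Ideal.quotientMap_injective' fun r hr ↦ ?_
    rw [Ideal.mem_comap, ← AdicCompletion.ker_evalₐ_eq_map hI, RingHom.mem_ker, hev] at hr
    exact Ideal.Quotient.eq_zero_iff_mem.mp hr
  · intro z
    obtain ⟨z, rfl⟩ := Ideal.Quotient.mk_surjective z
    obtain ⟨r, hr⟩ := Ideal.Quotient.mk_surjective (AdicCompletion.evalₐ I n z)
    refine ⟨Ideal.Quotient.mk _ r, ?_⟩
    rw [Ideal.quotientMap_mk, Ideal.Quotient.eq, ← AdicCompletion.ker_evalₐ_eq_map hI,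
      RingHom.mem_ker, map_sub, hev, hr, sub_self]

theorem finite_embdim_completion_noetherian_local
    (R : Type u) [CommRing R] [IsLocalRing R]
    (hfg : (IsLocalRing.maximalIdeal R).FG) :
    IsNoetherianRing (AdicCompletion (IsLocalRing.maximalIdeal R) R) ∧
    ∃ _h : IsLocalRing (AdicCompletion (IsLocalRing.maximalIdeal R) R),
      Ideal.map (algebraMap R (AdicCompletion (IsLocalRing.maximalIdeal R) R))
          (IsLocalRing.maximalIdeal R)
        = IsLocalRing.maximalIdeal (AdicCompletion (IsLocalRing.maximalIdeal R) R) ∧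
      ∀ n : ℕ, 1 ≤ n →
        Function.Bijective
          (Ideal.quotientMap
            (Ideal.map (algebraMap R (AdicCompletion (IsLocalRing.maximalIdeal R) R))
              (IsLocalRing.maximalIdeal R ^ n))
            (algebraMap R (AdicCompletion (IsLocalRing.maximalIdeal R) R))
            Ideal.le_comap_map) := by
  have hloc := AdicCompletion.isLocalRing_of_fg hfg
  have hmax := AdicCompletion.maximalIdeal_eq_map_of_fg hfg
  have hcomplete := AdicCompletion.isAdicComplete_of_fg hfg
  refine ⟨?_, hloc, hmax.symm, fun n _ ↦ AdicCompletion.bijective_quotientMap_pow hfg n⟩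
  let := Ideal.Quotient.field
    (IsLocalRing.maximalIdeal (AdicCompletion (IsLocalRing.maximalIdeal R) R))
  exact IsAdicComplete.isNoetherianRing_of_quotient
    (I := IsLocalRing.maximalIdeal (AdicCompletion (IsLocalRing.maximalIdeal R) R))
    (hmax ▸ hfg.map _)
end

section
/- Let (R, m) be a local ring of finite embedding dimension and let I be an arbitrary ideal of R. Then the completion of R/I with respect to its maximal ideal is naturally isomorphic to R̂/I·R̂, where R̂ is the m-adic completion of R. In particular, I·R̂ ∩ R = I if and only if I is closed. -/
/-!
STATEMENT 1: Let `(R, m)` be a local ring of finite embedding dimension and `I` a proper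
ideal of `R`.  The completion of `R/I` at its maximal ideal (which is the image of `m`)
is naturally isomorphic to `R̂/I·R̂`, and `I·R̂ ∩ R = I` iff `I` is closed
(i.e. `I = ⋂ₙ (I + m^n)`).
-/

universe u

namespace Ideal

variable {R : Type*} [CommRing R]

open Polynomial in
/-- The ideal of the Rees algebra of `m` whose degree `n` part is `m ^ n ⊓ (I ⊔ m ^ (n + 1))`.
Modulo the extension of `m` it is the ideal of leading forms of elements of `I`. -/
def reesLeadingForms (m I : Ideal R) : Ideal (reesAlgebra m) where
  carrier := {f | ∀ n, (f : R[X]).coeff n ∈ I ⊔ m ^ (n + 1)}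
  add_mem' hf hg n := by
    simpa using add_mem (hf n) (hg n)
  zero_mem' n := by simp
  smul_mem' h f hf n := by
    have key : ((h : R[X]) * (f : R[X])).coeff n ∈ I ⊔ m ^ (n + 1) := by
      rw [coeff_mul]
      refine _root_.sum_mem fun ij hij ↦ ?_
      rw [Finset.HasAntidiagonal.mem_antidiagonal] at hij
      have hle : m ^ ij.1 * (I ⊔ m ^ (ij.2 + 1)) ≤ I ⊔ m ^ (n + 1) := by
        rw [mul_sup, ← pow_add, ← add_assoc, hij]
        exact sup_le_sup_right mul_le_right _
      exact hle (mul_mem_mul (h.2 ij.1) (hf ij.2))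
    simpa using key

lemma map_algebraMap_le_reesLeadingForms_bot (m : Ideal R) :
    m.map (algebraMap R (reesAlgebra m)) ≤ reesLeadingForms m ⊥ := by
  rw [map_le_iff_le_comap]
  intro r hr n
  change (Polynomial.C r).coeff n ∈ _
  rw [Polynomial.coeff_C]
  split_ifs with h
  · subst h
    simpa using hr
  · exact zero_mem _

/-- The fibre `⨁ m ^ n / m ^ (n + 1)` of the Rees algebra is Noetherian. -/
lemma isNoetherianRing_reesAlgebra_quotient {m : Ideal R} [IsNoetherianRing (R ⧸ m)]
    (hm : m.FG) :
    IsNoetherianRing (reesAlgebra m ⧸ m.map (algebraMap R (reesAlgebra m))) := by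
  have : Algebra.FiniteType R (reesAlgebra m) := ⟨(reesAlgebra m).fg_top.mpr (reesAlgebra.fg hm)⟩
  have : Algebra.FiniteType R (reesAlgebra m ⧸ m.map (algebraMap R (reesAlgebra m))) :=
    .of_surjective (Ideal.Quotient.mkₐ R _) (Ideal.Quotient.mkₐ_surjective R _)
  have : Algebra.FiniteType (R ⧸ m) (reesAlgebra m ⧸ m.map (algebraMap R (reesAlgebra m))) :=
    .of_restrictScalars_finiteType R (R ⧸ m)
      (reesAlgebra m ⧸ m.map (algebraMap R (reesAlgebra m)))
  exact Algebra.FiniteType.isNoetherianRing (R ⧸ m)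
    (reesAlgebra m ⧸ m.map (algebraMap R (reesAlgebra m)))

lemma exists_finset_le_span_sup {A : Type*} [CommRing A] (K J : Ideal A)
    [IsNoetherianRing (A ⧸ K)] :
    ∃ t : Finset A, (t : Set A) ⊆ J ∧ J ≤ span (t : Set A) ⊔ K := by
  classical
  have h : (span (Ideal.Quotient.mk K '' (J : Set A))).FG := IsNoetherian.noetherian _
  obtain ⟨s, hs, hspan⟩ := (Submodule.fg_span_iff_fg_span_finset_subset _).mp h
  obtain ⟨t, ht, rfl⟩ := Finset.subset_set_image_iff.mp hs
  refine ⟨t, ht, fun x hx ↦ ?_⟩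
  have hx' : Ideal.Quotient.mk K x ∈ (span (t : Set A)).map (Ideal.Quotient.mk K) := by
    rw [map_span]
    have : Ideal.Quotient.mk K x ∈ span (Ideal.Quotient.mk K '' (J : Set A)) :=
      subset_span ⟨x, hx, rfl⟩
    rw [Finset.coe_image] at hspan
    exact hspan.le this
  rwa [← mem_comap, comap_map_of_surjective' _ Ideal.Quotient.mk_surjective, mk_ker] at hx'

/-- An Artin-Rees lemma up to higher powers of `m`, valid without assuming `R` Noetherian. -/
lemma exists_finset_mem_pow_mul_span_sup_pow {m : Ideal R} [IsNoetherianRing (R ⧸ m)]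
    (hm : m.FG) (I : Ideal R) :
    ∃ (D : ℕ) (s : Finset R), (s : Set R) ⊆ I ∧
      ∀ n, ∀ a ∈ I, a ∈ m ^ (n + D) → a ∈ m ^ n * span (s : Set R) ⊔ m ^ (n + D + 1) := by
  classical
  have := isNoetherianRing_reesAlgebra_quotient hm
  obtain ⟨t, ht, hJ⟩ := exists_finset_le_span_sup
    (m.map (algebraMap R (reesAlgebra m))) (reesLeadingForms m I)
  have hu : ∀ (g : reesAlgebra m) (j : ℕ), ∃ u ∈ I, g ∈ reesLeadingForms m I →
      (g : Polynomial R).coeff j - u ∈ m ^ (j + 1) := by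
    intro g j
    by_cases hg : g ∈ reesLeadingForms m I
    · obtain ⟨u, hu, v, hv, huv⟩ := Submodule.mem_sup.mp (hg j)
      exact ⟨u, hu, fun _ ↦ by simpa [← huv] using hv⟩
    · exact ⟨0, zero_mem _, fun h ↦ (hg h).elim⟩
  choose u huI hu using hu
  let D := t.sup fun g ↦ (g : Polynomial R).natDegree
  let s : Finset R := t.biUnion fun g ↦ (Finset.range (D + 1)).image (u g)
  refine ⟨D, s, ?_, fun n a ha ham ↦ ?_⟩
  · intro x hx
    simp only [s, Finset.coe_biUnion, Set.mem_iUnion, Finset.coe_image] at hx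
    obtain ⟨g, -, j, -, rfl⟩ := hx
    exact huI g j
  · let f : reesAlgebra m := ⟨Polynomial.monomial (n + D) a, reesAlgebra.monomial_mem.mpr ham⟩
    have hf : f ∈ reesLeadingForms m I := by
      intro k
      change (Polynomial.monomial (n + D) a).coeff k ∈ _
      rw [Polynomial.coeff_monomial]
      split_ifs
      · exact mem_sup_left ha
      · exact zero_mem _
    obtain ⟨p, hp, q, hq, hpq⟩ := Submodule.mem_sup.mp (hJ hf)
    have hq' := map_algebraMap_le_reesLeadingForms_bot m hq (n + D)
    rw [bot_sup_eq] at hq'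
    have ha' : a = (p : Polynomial R).coeff (n + D) + (q : Polynomial R).coeff (n + D) := by
      have h := congrArg (fun x : reesAlgebra m ↦ (x : Polynomial R).coeff (n + D)) hpq
      simpa [f] using h.symm
    rw [ha']
    refine add_mem ?_ (mem_sup_right hq')
    obtain ⟨c, -, hc⟩ := Submodule.mem_span_finset.mp hp
    have hp' : (p : Polynomial R).coeff (n + D) =
        ∑ g ∈ t, ((c g : Polynomial R) * (g : Polynomial R)).coeff (n + D) := by
      rw [← hc, ← Polynomial.finsetSum_coeff]
      simp
    rw [hp']
    refine _root_.sum_mem fun g hg ↦ ?_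
    rw [Polynomial.coeff_mul]
    refine _root_.sum_mem fun ij hij ↦ ?_
    rw [Finset.HasAntidiagonal.mem_antidiagonal] at hij
    by_cases hj : ij.2 ≤ D
    · rw [← sub_add_cancel ((g : Polynomial R).coeff ij.2) (u g ij.2), mul_add]
      refine add_mem (mem_sup_right ?_) (mem_sup_left ?_)
      · rw [← hij, add_assoc, pow_add]
        exact mul_mem_mul ((c g).2 _) (hu g _ (ht hg))
      · refine mul_mem_mul (pow_le_pow_right (by lia) ((c g).2 ij.1)) (subset_span ?_)
        simp only [s, Finset.coe_biUnion, Set.mem_iUnion, Finset.coe_image]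
        exact ⟨g, hg, ij.2, by simpa using by lia, rfl⟩
    · rw [Polynomial.coeff_eq_zero_of_natDegree_lt (n := ij.2), mul_zero]
      · exact zero_mem _
      · exact (Finset.le_sup (f := fun g : reesAlgebra m ↦ (g : Polynomial R).natDegree) hg).trans_lt
          (not_le.mp hj)

end Ideal

namespace AdicCompletion

variable {R : Type*} [CommRing R]

lemma factorPow_evalₐ (m : Ideal R) {k l : ℕ} (hkl : k ≤ l) (x : AdicCompletion m R) :
    Ideal.Quotient.factorPow m hkl (evalₐ m l x) = evalₐ m k x := by
  obtain ⟨X, rfl⟩ := mk_surjective m R x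
  rw [evalₐ_mk, evalₐ_mk, Ideal.Quotient.factor_mk]
  exact Ideal.mk_eq_mk m hkl X

/-- Extended ideals are closed in the completion at a finitely generated ideal. -/
lemma mem_map_algebraMap_iff {m : Ideal R} [IsNoetherianRing (R ⧸ m)] (hm : m.FG)
    (I : Ideal R) (x : AdicCompletion m R) :
    x ∈ I.map (algebraMap R (AdicCompletion m R)) ↔
      ∀ n, evalₐ m n x ∈ I.map (Ideal.Quotient.mk (m ^ n)) := by
  constructor
  · intro hx n
    have h := Ideal.mem_map_of_mem (evalₐ m n : AdicCompletion m R →+* R ⧸ m ^ n) hx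
    rw [Ideal.map_map, AlgHom.comp_algebraMap] at h
    exact h
  · intro hx
    obtain ⟨D, s, hs, hAR⟩ := Ideal.exists_finset_mem_pow_mul_span_sup_pow hm I
    have hx' : ∀ n, ∃ a ∈ I, Ideal.Quotient.mk (m ^ n) a = evalₐ m n x := fun n ↦
      (Ideal.mem_map_iff_of_surjective _ Ideal.Quotient.mk_surjective).mp (hx n)
    choose a haI ha using hx'
    have hcompat : ∀ {k l : ℕ}, k ≤ l → a l - a k ∈ m ^ k := by
      intro k l hkl
      rw [← Ideal.Quotient.eq, ha k, ← factorPow_evalₐ m hkl x, ← ha l, Ideal.Quotient.factor_mk]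
    let P : ℕ → (s → R) → Prop := fun n c ↦ a (n + D) - a D - ∑ i, c i * i ∈ m ^ (n + D)
    have step : ∀ (n : ℕ) (c : s → R), ∃ c' : s → R, P n c →
        P (n + 1) c' ∧ ∀ i, c' i - c i ∈ m ^ n := by
      intro n c
      by_cases hP : P n c
      · have hmem : a (n + 1 + D) - a D - ∑ i, c i * i ∈ m ^ (n + D) := by
          convert add_mem hP (hcompat (show n + D ≤ n + 1 + D by lia)) using 1
          ring
        have hI : a (n + 1 + D) - a D - ∑ i, c i * i ∈ I :=
          sub_mem (sub_mem (haI _) (haI _)) (sum_mem fun i _ ↦ I.mul_mem_left _ (hs i.2))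
        obtain ⟨y, hy, z, hz, hyz⟩ := Submodule.mem_sup.mp (hAR n _ hI hmem)
        have hy' : y ∈ m ^ n • Submodule.span R (Set.range fun i : s ↦ (i : R)) := by
          simpa using hy
        obtain ⟨d, hd, rfl⟩ := (Submodule.mem_ideal_smul_span_iff_exists_sum _ _ _).mp hy'
        refine ⟨fun i ↦ c i + d i, fun _ ↦ ⟨?_, fun i ↦ by simpa using hd i⟩⟩
        have hz' : z = a (n + 1 + D) - a D - ∑ i, (c i + d i) * i := by
          rw [eq_sub_of_add_eq' hyz, Finsupp.sum_fintype _ _ (by simp)]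
          simp only [add_mul, Finset.sum_add_distrib, smul_eq_mul]
          ring
        change a (n + 1 + D) - a D - ∑ i, (c i + d i) * i ∈ m ^ (n + 1 + D)
        rw [← hz', add_right_comm]
        exact hz
      · exact ⟨0, fun h ↦ (hP h).elim⟩
    choose next hnext using step
    let c : ℕ → s → R := fun n ↦ Nat.rec 0 next n
    have hP : ∀ n, P n (c n) := by
      intro n
      induction n with
      | zero => simp [P, c]
      | succ n ih => exact (hnext n _ ih).1
    have hc : ∀ n i, c (n + 1) i - c n i ∈ m ^ n := fun n ↦ (hnext n _ (hP n)).2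
    let C : s → AdicCompletion m R := fun i ↦ mk m R (.mk m R (fun n ↦ c n i) fun n ↦ by
      rw [SModEq.comm, SModEq.sub_mem]
      simpa using hc n i)
    have hxC : x = algebraMap R _ (a D) + ∑ i, C i * algebraMap R _ (i : R) := by
      refine ext_evalₐ fun n ↦ ?_
      have hC : ∀ i, evalₐ m n (C i) = Ideal.Quotient.mk (m ^ n) (c n i) := fun i ↦ evalₐ_mk m n _
      have hmem : a n - (a D + ∑ i, c n i * i) ∈ m ^ n := by
        convert sub_mem (Ideal.pow_le_pow_right (Nat.le_add_right n D) (hP n))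
          (hcompat (Nat.le_add_right n D)) using 1
        ring
      rw [← ha, Ideal.Quotient.eq.mpr hmem]
      simp [hC, Ideal.Quotient.algebraMap_eq]
    rw [hxC]
    exact add_mem (Ideal.mem_map_of_mem _ (haI D))
      (sum_mem fun i _ ↦ Ideal.mul_mem_left _ _ (Ideal.mem_map_of_mem _ (hs i.2)))

/-- The canonical ring homomorphism from the `m`-adic completion of `R` to the quotient of `R ⧸ I`
by the `n`-th power of the image of `m`. -/
noncomputable def evalQuotient (m I : Ideal R) (n : ℕ) :
    AdicCompletion m R →+* (R ⧸ I) ⧸ (m.map (Ideal.Quotient.mk I)) ^ n :=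
  (Ideal.quotientMap ((m.map (Ideal.Quotient.mk I)) ^ n) (Ideal.Quotient.mk I)
    (by rw [← Ideal.map_le_iff_le_comap, Ideal.map_pow])).comp
      (evalₐ m n : AdicCompletion m R →+* R ⧸ m ^ n)

lemma evalQuotient_apply (m I : Ideal R) (n : ℕ) {x : AdicCompletion m R} {r : R}
    (hr : Ideal.Quotient.mk (m ^ n) r = evalₐ m n x) :
    evalQuotient m I n x = Ideal.Quotient.mk _ (Ideal.Quotient.mk I r) := by
  rw [evalQuotient, RingHom.comp_apply, RingHom.coe_coe, ← hr, Ideal.quotientMap_mk]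

lemma factorPow_comp_evalQuotient (m I : Ideal R) {k l : ℕ} (hkl : k ≤ l) :
    (Ideal.Quotient.factorPow _ hkl).comp (evalQuotient m I l) = evalQuotient m I k := by
  ext x
  obtain ⟨r, hr⟩ := Ideal.Quotient.mk_surjective (evalₐ m l x)
  have hr' : Ideal.Quotient.mk (m ^ k) r = evalₐ m k x := by
    rw [← factorPow_evalₐ m hkl x, ← hr, Ideal.Quotient.factor_mk]
  rw [RingHom.comp_apply, evalQuotient_apply m I l hr, evalQuotient_apply m I k hr',
    Ideal.Quotient.factor_mk]

/-- The canonical ring homomorphism from the `m`-adic completion of `R` to the completion of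
`R ⧸ I` at the image of `m`. -/
noncomputable def toQuotient (m I : Ideal R) :
    AdicCompletion m R →+* AdicCompletion (m.map (Ideal.Quotient.mk I)) (R ⧸ I) :=
  liftRingHom _ (evalQuotient m I) (factorPow_comp_evalQuotient m I)

lemma evalₐ_toQuotient (m I : Ideal R) (n : ℕ) {x : AdicCompletion m R} {r : R}
    (hr : Ideal.Quotient.mk (m ^ n) r = evalₐ m n x) :
    evalₐ (m.map (Ideal.Quotient.mk I)) n (toQuotient m I x) =
      Ideal.Quotient.mk _ (Ideal.Quotient.mk I r) :=
  (evalₐ_liftRingHom _ _ (factorPow_comp_evalQuotient m I) n x).trans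
    (evalQuotient_apply m I n hr)

@[simp]
lemma toQuotient_algebraMap (m I : Ideal R) (r : R) :
    toQuotient m I (algebraMap R _ r) = algebraMap (R ⧸ I) _ (Ideal.Quotient.mk I r) := by
  refine ext_evalₐ fun n ↦ ?_
  rw [evalₐ_toQuotient m I n (r := r) (by simp [Ideal.Quotient.algebraMap_eq])]
  simp [Ideal.Quotient.algebraMap_eq]

lemma evalₐ_toQuotient_eq_zero_iff (m I : Ideal R) (n : ℕ) (x : AdicCompletion m R) :
    evalₐ (m.map (Ideal.Quotient.mk I)) n (toQuotient m I x) = 0 ↔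
      evalₐ m n x ∈ I.map (Ideal.Quotient.mk (m ^ n)) := by
  obtain ⟨r, hr⟩ := Ideal.Quotient.mk_surjective (evalₐ m n x)
  rw [evalₐ_toQuotient m I n hr, ← hr, Ideal.Quotient.eq_zero_iff_mem, ← Ideal.map_pow,
    ← Ideal.mem_comap, ← Ideal.mem_comap,
    Ideal.comap_map_of_surjective' _ Ideal.Quotient.mk_surjective,
    Ideal.comap_map_of_surjective' _ Ideal.Quotient.mk_surjective, Ideal.mk_ker, Ideal.mk_ker,
    sup_comm]

lemma ker_toQuotient {m : Ideal R} [IsNoetherianRing (R ⧸ m)] (hm : m.FG) (I : Ideal R) :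
    RingHom.ker (toQuotient m I) = I.map (algebraMap R (AdicCompletion m R)) := by
  ext x
  rw [RingHom.mem_ker, mem_map_algebraMap_iff hm]
  simp_rw [← evalₐ_toQuotient_eq_zero_iff]
  exact ⟨fun h n ↦ by rw [h, _root_.map_zero], fun h ↦ ext_evalₐ fun n ↦ by rw [h, _root_.map_zero]⟩

lemma toQuotient_surjective {m : Ideal R} (hm : m.FG) (I : Ideal R) :
    Function.Surjective (toQuotient m I) := by
  have := (IsAdicComplete.map_algebraMap_iff (S := AdicCompletion m R) m (AdicCompletion m R)).mpr
    (isAdicComplete (M := R) hm)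
  have hmap : (m.map (algebraMap R (AdicCompletion m R))).map (toQuotient m I) =
      (m.map (Ideal.Quotient.mk I)).map (algebraMap (R ⧸ I)
        (AdicCompletion (m.map (Ideal.Quotient.mk I)) (R ⧸ I))) := by
    rw [Ideal.map_map, Ideal.map_map]
    exact congrArg (fun f ↦ m.map f) (RingHom.ext fun r ↦ toQuotient_algebraMap m I r)
  have : IsHausdorff ((m.map (algebraMap R (AdicCompletion m R))).map (toQuotient m I))
      (AdicCompletion (m.map (Ideal.Quotient.mk I)) (R ⧸ I)) := by
    rw [hmap, IsHausdorff.map_algebraMap_iff]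
    infer_instance
  refine surjective_of_mk_map_comp_surjective
    (I := m.map (algebraMap R (AdicCompletion m R))) _ fun y ↦ ?_
  obtain ⟨z, rfl⟩ := Ideal.Quotient.mk_surjective y
  obtain ⟨r', hr'⟩ := Ideal.Quotient.mk_surjective (evalOneₐ (m.map (Ideal.Quotient.mk I)) z)
  obtain ⟨r, rfl⟩ := Ideal.Quotient.mk_surjective r'
  refine ⟨algebraMap R _ r, ?_⟩
  rw [RingHom.comp_apply, Ideal.Quotient.eq, hmap, ← ker_evalOneₐ_eq_map _ (hm.map _),
    toQuotient_algebraMap]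
  change evalOneₐ _ _ = 0
  rw [map_sub, ← hr', AlgHom.commutes, Ideal.Quotient.algebraMap_eq, sub_self]

lemma comap_map_algebraMap_eq_iInf {m : Ideal R} [IsNoetherianRing (R ⧸ m)] (hm : m.FG)
    (I : Ideal R) :
    (I.map (algebraMap R (AdicCompletion m R))).comap (algebraMap R (AdicCompletion m R)) =
      ⨅ n : ℕ, I + m ^ n := by
  ext r
  rw [Ideal.mem_comap, mem_map_algebraMap_iff hm, Ideal.mem_iInf]
  refine forall_congr' fun n ↦ ?_
  rw [AlgHom.commutes, Ideal.Quotient.algebraMap_eq, ← Ideal.mem_comap,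
    Ideal.comap_map_of_surjective' _ Ideal.Quotient.mk_surjective, Ideal.mk_ker, Ideal.add_eq_sup]

end AdicCompletion

theorem completion_quotient_and_closed_iff_contracted
    (R : Type u) [CommRing R] [IsLocalRing R]
    (hfg : (IsLocalRing.maximalIdeal R).FG)
    (I : Ideal R) (hI : I ≠ ⊤) :
    (∃ e : AdicCompletion (Ideal.map (Ideal.Quotient.mk I) (IsLocalRing.maximalIdeal R)) (R ⧸ I)
          ≃+* (AdicCompletion (IsLocalRing.maximalIdeal R) R ⧸
                Ideal.map (algebraMap R (AdicCompletion (IsLocalRing.maximalIdeal R) R)) I),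
        ∀ x : R,
          e (algebraMap (R ⧸ I)
              (AdicCompletion (Ideal.map (Ideal.Quotient.mk I) (IsLocalRing.maximalIdeal R)) (R ⧸ I))
              (Ideal.Quotient.mk I x))
            = Ideal.Quotient.mk _
                (algebraMap R (AdicCompletion (IsLocalRing.maximalIdeal R) R) x)) ∧
    ((Ideal.comap (algebraMap R (AdicCompletion (IsLocalRing.maximalIdeal R) R))
        (Ideal.map (algebraMap R (AdicCompletion (IsLocalRing.maximalIdeal R) R)) I) = I)
      ↔ I = ⨅ n : ℕ, I + IsLocalRing.maximalIdeal R ^ n) := by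
  have : IsNoetherianRing (R ⧸ IsLocalRing.maximalIdeal R) :=
    inferInstanceAs (IsNoetherianRing (IsLocalRing.ResidueField R))
  constructor
  · let e := (Ideal.quotEquivOfEq (AdicCompletion.ker_toQuotient hfg I).symm).trans
      (RingHom.quotientKerEquivOfSurjective (AdicCompletion.toQuotient_surjective hfg I))
    refine ⟨e.symm, fun x ↦ e.symm_apply_eq.mpr ?_⟩
    exact (AdicCompletion.toQuotient_algebraMap _ I x).symm
  · rw [AdicCompletion.comap_map_algebraMap_eq_iInf hfg]
    exact eq_comm
end

section
/- A local ring (R, m) is Noetherian if and only if its maximal ideal m is finitely generated and every ideal of R is closed (i.e., every ideal I satisfies I = ⋂_n (I + m^n)). -/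
/-!
STATEMENT 2: A local ring `(R, m)` is Noetherian iff `m` is finitely generated and every
ideal of `R` is closed, i.e. every ideal `I` satisfies `I = ⋂ₙ (I + m^n)`.
-/

universe u

theorem Ideal.exists_maximal_not_fg {R : Type*} [CommRing R] {I : Ideal R} (hI : ¬ I.FG) :
    ∃ M : Ideal R, Maximal (fun J : Ideal R => ¬ J.FG) M := by
  obtain ⟨M, _, hM⟩ : ∃ M, I ≤ M ∧ Maximal (fun J : Ideal R => ¬ J.FG) M := by
    refine zorn_le_nonempty₀ {J : Ideal R | ¬ J.FG}
      (fun C hC hchain J hJ => ⟨sSup C, fun hfg => ?_, fun _ => le_sSup⟩) I hI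
    obtain ⟨K, hK, hle⟩ := (CompleteLattice.isCompactElement_iff_le_of_directed_sSup_le _ _).1
      ((Submodule.fg_iff_compact _).1 hfg) C ⟨J, hJ⟩ hchain.directedOn le_rfl
    exact hC hK (le_antisymm (le_sSup hK) hle ▸ hfg)
  exact ⟨M, hM⟩

theorem Ideal.exists_fg_le_sup_span_singleton {R : Type*} [CommRing R] {I : Ideal R} {x : R}
    (h : (I ⊔ Ideal.span {x}).FG) :
    ∃ J : Ideal R, J.FG ∧ J ≤ I ∧ I ≤ J ⊔ Ideal.span {x} := by
  obtain ⟨n, f, hf⟩ := Submodule.fg_iff_exists_fin_generating_family.1 h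
  have hdecomp (k : Fin n) : ∃ r : R, ∃ p ∈ I, r * x + p = f k := by
    apply Ideal.mem_span_singleton_sup.1
    rw [sup_comm, ← hf]
    exact Submodule.subset_span (Set.mem_range_self k)
  choose r p hp hrp using hdecomp
  refine ⟨Ideal.span (Set.range p), Submodule.fg_span (Set.finite_range p), ?_, ?_⟩
  · rw [Ideal.span_le]
    rintro _ ⟨k, rfl⟩
    exact hp k
  · refine le_sup_left.trans (hf.symm.le.trans (Submodule.span_le.2 ?_))
    rintro _ ⟨k, rfl⟩
    rw [← hrp k, add_comm]
    exact Submodule.add_mem_sup (Ideal.subset_span (Set.mem_range_self k))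
      (Ideal.mul_mem_left _ _ (Ideal.mem_span_singleton_self x))

theorem Ideal.IsPrime.le_sup_span_singleton_pow {R : Type*} [CommRing R] {P J : Ideal R}
    (hP : P.IsPrime) {x : R} (hx : x ∉ P) (hJP : J ≤ P) (hPJ : P ≤ J ⊔ Ideal.span {x}) (n : ℕ) :
    P ≤ J ⊔ Ideal.span {x ^ n} := by
  suffices h : ∀ y ∈ P, ∃ q ∈ J, ∃ r ∈ P, r * x ^ n + q = y by
    intro y hy
    obtain ⟨q, hq, r, -, h⟩ := h y hy
    rw [sup_comm]
    exact Ideal.mem_span_singleton_sup.2 ⟨r, q, hq, h⟩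
  induction n with
  | zero => exact fun y hy => ⟨0, J.zero_mem, y, hy, by simp⟩
  | succ n ih =>
    intro y hy
    obtain ⟨q, hq, r, hr, rfl⟩ := ih y hy
    have hr' := hPJ hr
    rw [sup_comm] at hr'
    obtain ⟨s, t, ht, rfl⟩ := Ideal.mem_span_singleton_sup.1 hr'
    have hs : s ∈ P :=
      (hP.mem_or_mem ((P.add_mem_iff_left (hJP ht)).1 hr)).resolve_right hx
    exact ⟨t * x ^ n + q, J.add_mem (J.mul_mem_right _ ht) hq, s, hs, by ring⟩

theorem Ideal.iInf_sup_pow_eq_of_le_jacobson_bot {R : Type*} [CommRing R] [IsNoetherianRing R]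
    {a : Ideal R} (ha : a ≤ Ideal.jacobson ⊥) (I : Ideal R) :
    ⨅ n : ℕ, I ⊔ a ^ n = I := by
  refine le_antisymm (fun x hx => ?_) (le_iInf fun _ => le_sup_left)
  rw [← Ideal.Quotient.eq_zero_iff_mem]
  refine (IsHausdorff.of_le_jacobson a (R ⧸ I) ha).haus _ fun n => ?_
  rw [SModEq.zero]
  obtain ⟨y, hy, z, hz, rfl⟩ := Submodule.mem_sup.1 (Ideal.mem_iInf.1 hx n)
  rw [map_add, Ideal.Quotient.eq_zero_iff_mem.2 hy, zero_add]
  have h := Submodule.smul_mem_smul hz (Submodule.mem_top (x := (1 : R ⧸ I)))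
  rwa [Algebra.smul_def, mul_one] at h

theorem IsLocalRing.isNoetherianRing_of_iInf_sup_pow_le {R : Type*} [CommRing R] [IsLocalRing R]
    (hm : (IsLocalRing.maximalIdeal R).FG)
    (hclosed : ∀ I : Ideal R, I.FG → ⨅ n : ℕ, I ⊔ IsLocalRing.maximalIdeal R ^ n ≤ I) :
    IsNoetherianRing R := by
  rw [isNoetherianRing_iff_ideal_fg]
  by_contra! ⟨I, hI⟩
  obtain ⟨P, hPmax⟩ := Ideal.exists_maximal_not_fg hI
  have hP : P.IsPrime := Ideal.isOka_fg.isPrime_of_maximal_not hPmax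
  have hlt : P < IsLocalRing.maximalIdeal R :=
    (IsLocalRing.le_maximalIdeal hP.ne_top).lt_of_ne fun h => hPmax.prop (h ▸ hm)
  obtain ⟨x, hxm, hxP⟩ := SetLike.exists_of_lt hlt
  obtain ⟨J, hJ, hJP, hPJ⟩ := Ideal.exists_fg_le_sup_span_singleton <|
    of_not_not <| hPmax.not_prop_of_gt (Submodule.lt_sup_iff_notMem.2 hxP)
  have hle : P ≤ J := (le_iInf fun n =>
    (hP.le_sup_span_singleton_pow hxP hJP hPJ n).trans <| sup_le_sup_left
      ((Ideal.span_singleton_le_iff_mem _).2 (Ideal.pow_mem_pow hxm n)) J).trans (hclosed J hJ)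
  exact hPmax.prop (le_antisymm hle hJP ▸ hJ)

theorem noetherian_iff_fg_maximalIdeal_and_ideals_closed
    (R : Type u) [CommRing R] [IsLocalRing R] :
    IsNoetherianRing R ↔
      ((IsLocalRing.maximalIdeal R).FG ∧
        ∀ I : Ideal R, I = ⨅ n : ℕ, I + IsLocalRing.maximalIdeal R ^ n) := by
  refine ⟨fun _ => ⟨(IsLocalRing.maximalIdeal R).fg_of_isNoetherianRing, fun I => ?_⟩, fun h => ?_⟩
  · exact (Ideal.iInf_sup_pow_eq_of_le_jacobson_bot
      (IsLocalRing.maximalIdeal_le_jacobson _) I).symm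
  · exact IsLocalRing.isNoetherianRing_of_iInf_sup_pow_le h.1 fun I _ => (h.2 I).ge
end

section
/- Let (R, m) be a local ring of finite embedding dimension and let R̂ be its m-adic completion. The image of the canonical map Spec(R̂) → Spec(R), sending a prime ideal of R̂ to its contraction in R, consists exactly of the closed prime ideals of R. -/
/-!
STATEMENT 4: For a local ring `(R, m)` of finite embedding dimension, the image of the
canonical map `Spec(R̂) → Spec(R)` (contraction along `R → R̂ = AdicCompletion m R`)
consists exactly of the closed prime ideals of `R`.
-/

universe u

universe v

open Polynomial in
/-- The associated graded ring of a finitely generated ideal with Noetherian quotient,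
presented as a quotient of the Rees algebra, is Noetherian. -/
theorem reesAlgebra.isNoetherianRing_quotient_map {A : Type*} [CommRing A] {I : Ideal A}
    (hI : I.FG) [IsNoetherianRing (A ⧸ I)] :
    IsNoetherianRing (reesAlgebra I ⧸ I.map (algebraMap A (reesAlgebra I))) := by
  have : Algebra.FiniteType A (reesAlgebra I) := ⟨(reesAlgebra I).fg_top.mpr (reesAlgebra.fg hI)⟩
  have : IsNoetherianRing (TensorProduct A (A ⧸ I) (reesAlgebra I)) :=
    Algebra.FiniteType.isNoetherianRing (A ⧸ I) _
  exact isNoetherianRing_of_ringEquiv _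
    (Algebra.TensorProduct.quotIdealMapEquivQuotTensor (reesAlgebra I) I).symm.toRingEquiv

open Polynomial in
theorem reesAlgebra.coeff_mem_pow_succ_of_mem_map {A : Type*} [CommRing A] {I : Ideal A}
    {x : reesAlgebra I} (hx : x ∈ I.map (algebraMap A (reesAlgebra I))) (d : ℕ) :
    (x : A[X]).coeff d ∈ I ^ (d + 1) := by
  induction hx using Submodule.span_induction generalizing d with
  | mem x hx =>
    obtain ⟨a, ha, rfl⟩ := hx
    change (C a : A[X]).coeff d ∈ _
    rw [coeff_C]
    split_ifs with h
    · simpa [h] using ha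
    · exact zero_mem _
  | zero => simp
  | add x y _ _ hx hy => simpa using add_mem (hx d) (hy d)
  | smul a x _ hx =>
    rw [smul_eq_mul, Subalgebra.coe_mul, coeff_mul]
    refine _root_.sum_mem fun ij hij => ?_
    rw [← Finset.HasAntidiagonal.mem_antidiagonal.mp hij, add_assoc, pow_add]
    exact Ideal.mul_mem_mul (a.2 _) (hx _)

open Polynomial in
/-- If `I` is finitely generated with Noetherian quotient, then for every ideal `J` there are
finitely many elements of `J` whose initial forms generate the initial ideal of `J`. -/
theorem Ideal.exists_finite_initial_generators {A : Type v} [CommRing A] {I : Ideal A}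
    (hI : I.FG) [IsNoetherianRing (A ⧸ I)] (J : Ideal A) :
    ∃ (s : Type v) (_ : Fintype s) (a : s → A) (D : ℕ), (∀ i, a i ∈ J) ∧
      ∀ n, ∀ y ∈ J, y ∈ I ^ n → ∃ c : s → A, (∀ i, c i ∈ I ^ (n - D)) ∧
        y - ∑ i, c i * a i ∈ I ^ (n + 1) := by
  classical
  have := reesAlgebra.isNoetherianRing_quotient_map hI
  let π := Ideal.Quotient.mk (I.map (algebraMap A (reesAlgebra I)))
  let G : Set (reesAlgebra I) := {t | ∃ d, ∃ a ∈ J, (t : A[X]) = monomial d a}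
  obtain ⟨s, hsG, hs⟩ := (Submodule.fg_span_iff_fg_span_finset_subset (π '' G)).mp
    (IsNoetherian.noetherian (Ideal.span (π '' G)))
  have hsG' : ∀ i : s, ∃ t ∈ G, π t = i := fun i => hsG i.2
  choose t htG hti using hsG'
  choose d a haJ hda using htG
  refine ⟨s, inferInstance, a, Finset.univ.sup d, haJ, fun n y hyJ hyI => ?_⟩
  let g : reesAlgebra I := ⟨monomial n y, reesAlgebra.monomial_mem.mpr hyI⟩
  have hg : π g ∈ Ideal.span (Set.range fun i : s => π (t i)) := by
    have : (Set.range fun i : s => π (t i)) = s := by simp [hti]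
    rw [this, Ideal.span, ← hs]
    exact Submodule.subset_span ⟨g, ⟨n, y, hyJ, rfl⟩, rfl⟩
  obtain ⟨c', hc'⟩ := (Submodule.mem_span_range_iff_exists_fun _).mp hg
  choose h hh using fun i => Ideal.Quotient.mk_surjective (c' i)
  have hmem : g - ∑ i, h i * t i ∈ I.map (algebraMap A (reesAlgebra I)) := by
    rw [← Ideal.Quotient.eq_zero_iff_mem, map_sub, map_sum, sub_eq_zero]
    simp only [map_mul, hh]
    exact hc'.symm
  refine ⟨fun i => if d i ≤ n then (h i : A[X]).coeff (n - d i) else 0, fun i => ?_, ?_⟩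
  · dsimp only
    split_ifs
    · exact Ideal.pow_le_pow_right
        (Nat.sub_le_sub_left (Finset.le_sup (f := d) (Finset.mem_univ i)) n) ((h i).2 _)
    · exact zero_mem _
  · convert reesAlgebra.coeff_mem_pow_succ_of_mem_map hmem n using 1
    have hcoeff : ∀ i, ((h i : A[X]) * monomial (d i) (a i)).coeff n =
        (if d i ≤ n then (h i : A[X]).coeff (n - d i) else 0) * a i := fun i => by
      rw [← C_mul_X_pow_eq_monomial, ← mul_assoc, coeff_mul_X_pow', coeff_mul_C, ite_mul, zero_mul]
    simp only [AddSubgroupClass.coe_sub, AddSubmonoidClass.coe_finsetSum, MulMemClass.coe_mul,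
      hda, coeff_sub, finsetSum_coeff, hcoeff, g, coeff_monomial_same]

/-- In a ring complete for a finitely generated ideal `I` with Noetherian quotient,
every ideal is closed in the `I`-adic topology. -/
theorem Ideal.iInf_sup_pow_eq_self_of_isAdicComplete {A : Type*} [CommRing A] {I : Ideal A}
    (hI : I.FG) [IsNoetherianRing (A ⧸ I)] [IsAdicComplete I A] (J : Ideal A) :
    ⨅ n : ℕ, J ⊔ I ^ n = J := by
  refine le_antisymm (fun y hy => ?_) (le_iInf fun n => le_sup_left)
  obtain ⟨s, _, a, D, haJ, H⟩ := Ideal.exists_finite_initial_generators hI J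
  have step : ∀ n (b : s → A), y - ∑ i, b i * a i ∈ I ^ n → ∃ b' : s → A,
      y - ∑ i, b' i * a i ∈ I ^ (n + 1) ∧ ∀ i, b' i - b i ∈ I ^ (n - D) := by
    intro n b hb
    obtain ⟨j, hj, e, he, hje⟩ := Submodule.mem_sup.mp ((Submodule.mem_iInf _).mp hy (n + 1))
    have hsum : ∑ i, b i * a i ∈ J := _root_.sum_mem fun i _ => J.mul_mem_left _ (haJ i)
    obtain ⟨c, hc, hc'⟩ := H n (j - ∑ i, b i * a i) (sub_mem hj hsum) (by
      have := sub_mem hb (Ideal.pow_le_pow_right n.le_succ he)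
      rwa [← hje, show j + e - ∑ i, b i * a i - e = j - ∑ i, b i * a i by ring] at this)
    refine ⟨b + c, ?_, fun i => by simpa using hc i⟩
    convert add_mem hc' he using 1
    simp only [← hje, Pi.add_apply, add_mul, Finset.sum_add_distrib]
    ring
  choose! f hf hf' using step
  let b : ℕ → s → A := fun n => Nat.rec 0 f n
  have hb : ∀ n, y - ∑ i, b n i * a i ∈ I ^ n := fun n => by
    induction n with
    | zero => simp
    | succ n ih => exact hf n _ ih
  have hcauchy : ∀ m n, m ≤ n → ∀ i, b n i - b m i ∈ I ^ (m - D) := fun m n hmn i => by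
    induction n, hmn using Nat.le_induction with
    | base => simp
    | succ n hmn ih =>
      rw [← sub_add_sub_cancel _ (b n i)]
      exact add_mem (Ideal.pow_le_pow_right (Nat.sub_le_sub_right hmn D) (hf' n _ (hb n) i)) ih
  have hlim : ∀ i, ∃ l, ∀ n, b (n + D) i - l ∈ I ^ n := fun i => by
    obtain ⟨l, hl⟩ := IsPrecomplete.prec' (I := I) (fun n => b (n + D) i) (fun {m n} hmn => by
      rw [SModEq.sub_mem, ← neg_mem_iff, neg_sub]
      simpa using hcauchy (m + D) (n + D) (by lia) i)
    exact ⟨l, fun n => by simpa [SModEq.sub_mem] using hl n⟩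
  choose l hl using hlim
  have hyl : y - ∑ i, l i * a i = 0 := by
    refine IsHausdorff.haus' (I := I) _ fun n => ?_
    rw [SModEq.sub_mem, sub_zero, smul_eq_mul, Ideal.mul_top]
    have h₁ := Ideal.pow_le_pow_right (Nat.le_add_right n D) (hb (n + D))
    have h₂ : ∑ i, (b (n + D) i - l i) * a i ∈ I ^ n :=
      _root_.sum_mem fun i _ => Ideal.mul_mem_right _ _ (hl i n)
    convert add_mem h₁ h₂ using 1
    simp only [sub_mul, Finset.sum_sub_distrib]
    ring
  rw [sub_eq_zero.mp hyl]
  exact _root_.sum_mem fun i _ => J.mul_mem_left _ (haJ i)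

theorem AdicCompletion.comap_map_algebraMap_le {R : Type*} [CommRing R] (I p : Ideal R) :
    (p.map (algebraMap R (AdicCompletion I R))).comap (algebraMap R (AdicCompletion I R)) ≤
      ⨅ n : ℕ, p ⊔ I ^ n := by
  refine le_iInf fun n x hx => ?_
  have h := Ideal.mem_map_of_mem (AdicCompletion.evalₐ I n).toRingHom (Ideal.mem_comap.mp hx)
  rw [Ideal.map_map] at h
  have hcomp : (AdicCompletion.evalₐ I n).toRingHom.comp (algebraMap R (AdicCompletion I R)) =
      Ideal.Quotient.mk (I ^ n) := (AdicCompletion.evalₐ I n).comp_algebraMap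
  have hx' := RingHom.congr_fun hcomp x
  rw [RingHom.comp_apply] at hx'
  rw [hcomp, hx', ← Ideal.mem_comap,
    Ideal.comap_map_of_surjective' _ Ideal.Quotient.mk_surjective, Ideal.mk_ker] at h
  exact h

theorem image_spec_completion_eq_closed_primes
    (R : Type u) [CommRing R] [IsLocalRing R]
    (hfg : (IsLocalRing.maximalIdeal R).FG) :
    {p : Ideal R |
        ∃ P : Ideal (AdicCompletion (IsLocalRing.maximalIdeal R) R), P.IsPrime ∧
          Ideal.comap (algebraMap R (AdicCompletion (IsLocalRing.maximalIdeal R) R)) P = p}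
      = {p : Ideal R | p.IsPrime ∧ p = ⨅ n : ℕ, p + IsLocalRing.maximalIdeal R ^ n} := by
  set m := IsLocalRing.maximalIdeal R
  ext p
  simp only [Set.mem_ofPred_eq]
  constructor
  · rintro ⟨P, hP, rfl⟩
    refine ⟨hP.comap _, le_antisymm (le_iInf fun n => le_sup_left) fun x hx => ?_⟩
    have := AdicCompletion.isAdicComplete_self m hfg
    have := AdicCompletion.isMaximal_map_of_le m m le_rfl hfg
    let := Ideal.Quotient.field (m.map (algebraMap R (AdicCompletion m R)))
    rw [Ideal.mem_comap, ← Ideal.iInf_sup_pow_eq_self_of_isAdicComplete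
      (hfg.map (algebraMap R (AdicCompletion m R))) P]
    refine (Submodule.mem_iInf _).mpr fun n => ?_
    have h := Ideal.mem_map_of_mem (algebraMap R (AdicCompletion m R))
      ((Submodule.mem_iInf _).mp hx n)
    rw [Submodule.add_eq_sup, Ideal.map_sup, Ideal.map_pow] at h
    exact sup_le_sup_right (Ideal.map_comap_le (K := P)) (m.map _ ^ n) h
  · rintro ⟨hp, hclosed⟩
    refine (Ideal.comap_map_eq_self_iff_of_isPrime p).mp (le_antisymm ?_ Ideal.le_comap_map)
    exact (AdicCompletion.comap_map_algebraMap_le m p).trans hclosed.ge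
end

section
/- Let (R, m) be a local ring of finite embedding dimension. If the m-adic completion R̂ of R is Artinian, then R itself is Artinian (indeed m^n = 0 for some n). -/
/-!
STATEMENT 5: If `(R, m)` is a local ring of finite embedding dimension whose `m`-adic
completion is Artinian, then `R` is Artinian; indeed `m^n = 0` for some `n`.
-/

universe u

/-- If the completion is Artinian, the powers of the ideal stabilise. -/
theorem AdicCompletion.exists_pow_le_pow_succ {R : Type u} [CommRing R] (I : Ideal R)
    [IsArtinianRing (AdicCompletion I R)] : ∃ n : ℕ, I ^ n ≤ I ^ (n + 1) := by
  have anti : Antitone fun n : ℕ ↦ RingHom.ker (AdicCompletion.evalₐ I n) := by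
    intro a b hab x hx
    obtain ⟨y, rfl⟩ := AdicCompletion.mk_surjective I R x
    simp only [RingHom.mem_ker, AdicCompletion.evalₐ_mk] at hx ⊢
    refine (AdicCompletion.Ideal.mk_eq_mk I hab y).symm.trans (Ideal.Quotient.eq_zero_iff_mem.mpr ?_)
    exact Ideal.pow_le_pow_right hab (Ideal.Quotient.eq_zero_iff_mem.mp hx)
  obtain ⟨n, hn⟩ := IsArtinian.monotone_stabilizes
    (⟨fun n ↦ OrderDual.toDual (RingHom.ker (AdicCompletion.evalₐ I n)), anti⟩ :
      ℕ →o (Ideal (AdicCompletion I R))ᵒᵈ)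
  refine ⟨n, fun x hx ↦ ?_⟩
  have h : RingHom.ker (AdicCompletion.evalₐ I n) = RingHom.ker (AdicCompletion.evalₐ I (n + 1)) :=
    hn (n + 1) n.le_succ
  have hmem : AdicCompletion.of I R x ∈ RingHom.ker (AdicCompletion.evalₐ I n) := by
    rw [RingHom.mem_ker, AdicCompletion.evalₐ_of]
    exact Ideal.Quotient.eq_zero_iff_mem.mpr hx
  rw [h, RingHom.mem_ker, AdicCompletion.evalₐ_of] at hmem
  exact Ideal.Quotient.eq_zero_iff_mem.mp hmem

/-- A local ring with finitely generated nilpotent maximal ideal is Noetherian. -/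
theorem IsLocalRing.isNoetherianRing_of_fg_of_pow_eq_bot {R : Type u} [CommRing R] [IsLocalRing R]
    (hfg : (IsLocalRing.maximalIdeal R).FG) {n : ℕ} (hn : IsLocalRing.maximalIdeal R ^ n = ⊥) :
    IsNoetherianRing R := by
  refine IsNoetherianRing.of_prime fun P hP ↦ ?_
  have hle : IsLocalRing.maximalIdeal R ≤ P := hP.le_of_pow_le (n := n) (hn.le.trans bot_le)
  rwa [← le_antisymm hle (IsLocalRing.le_maximalIdeal hP.ne_top)]

theorem artinian_of_artinian_completion
    (R : Type u) [CommRing R] [IsLocalRing R]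
    (hfg : (IsLocalRing.maximalIdeal R).FG)
    (hart : IsArtinianRing (AdicCompletion (IsLocalRing.maximalIdeal R) R)) :
    IsArtinianRing R ∧ ∃ n : ℕ, IsLocalRing.maximalIdeal R ^ n = ⊥ := by
  obtain ⟨n, hn⟩ := AdicCompletion.exists_pow_le_pow_succ (IsLocalRing.maximalIdeal R)
  have hbot : IsLocalRing.maximalIdeal R ^ n = ⊥ := by
    refine Submodule.eq_bot_of_le_smul_of_le_jacobson_bot (IsLocalRing.maximalIdeal R) _ hfg.pow
      ?_ (IsLocalRing.maximalIdeal_le_jacobson _)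
    rwa [smul_eq_mul, ← pow_succ']
  have := IsLocalRing.isNoetherianRing_of_fg_of_pow_eq_bot hfg hbot
  exact ⟨(isArtinianRing_iff_isNilpotent_maximalIdeal R).mpr ⟨n, hbot⟩, n, hbot⟩
end

section
/- Let (R, m) be a local ring of finite embedding dimension with residue field k = R/m. Then the following natural numbers are all equal: (1) the least n such that there exist elements x_1, …, x_n ∈ m with R/(x_1, …, x_n) Artinian; (2) the Krull dimension of the m-adic completion R̂ of R; (3) the Krull dimension of the associated graded ring gr_m(R) = ⊕_{n≥0} m^n/m^{n+1}; (4) the degree of the Hilbert–Samuel polynomial of R, i.e., of the unique polynomial HS_R ∈ ℚ[T] such that HS_R(n) equals the length of the R-module R/m^n for all sufficiently large n. -/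
/-!
STATEMENT 6: For a local ring `(R, m)` of finite embedding dimension, the following
natural numbers are all equal:
(1) the least `n` such that some `n`-tuple of elements of `m` generates an ideal with
    Artinian quotient;
(2) the Krull dimension of the `m`-adic completion `R̂`;
(3) the Krull dimension of the associated graded ring `gr_m(R) = ⊕ m^n/m^{n+1}`
    (realized by its standard presentation `Rees(m)/m·Rees(m)`);
(4) the degree of the Hilbert–Samuel polynomial of `R`, the unique rational polynomial
    whose value at `n` is the length of `R/m^n` for all large `n`.
-/

universe u v

/-- The length of a module, i.e. the longest chain of submodules. -/
noncomputable def modLength (R : Type u) (M : Type v) [Ring R] [AddCommGroup M]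
    [Module R M] : WithBot ℕ∞ :=
  Order.krullDim (Submodule R M)

/-- The associated graded ring of a local ring `(R, m)`, presented as
`Rees(m)/m·Rees(m) ≅ ⊕ₙ m^n/m^{n+1}`. -/
abbrev AssocGradedOfLocal (R : Type u) [CommRing R] [IsLocalRing R] :=
  (reesAlgebra (IsLocalRing.maximalIdeal R)) ⧸
    Ideal.map (algebraMap R (reesAlgebra (IsLocalRing.maximalIdeal R)))
      (IsLocalRing.maximalIdeal R)

theorem length_quotient_anti {R : Type u} [CommRing R] {I J : Ideal R} (h : I ≤ J) :
    Module.length R (R ⧸ J) ≤ Module.length R (R ⧸ I) :=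
  Module.length_le_of_surjective (Submodule.factor h) (Submodule.factor_surjective h)

/-- Multiplication by `y` splits `R ⧸ J` into `R ⧸ (J : y)` and `R ⧸ (J, y)`. -/
theorem length_quotient_eq_add {R : Type u} [CommRing R] (J : Ideal R) (y : R) :
    Module.length R (R ⧸ J) =
      Module.length R (R ⧸ (Submodule.comap (LinearMap.mulLeft R y) J : Ideal R)) +
        Module.length R (R ⧸ (J ⊔ Ideal.span {y})) := by
  refine Module.length_eq_add_of_exact
    (Submodule.mapQ (Submodule.comap (LinearMap.mulLeft R y) J) J (LinearMap.mulLeft R y) le_rfl)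
    (Submodule.factor (le_sup_left : J ≤ J ⊔ Ideal.span {y})) ?_
    (Submodule.factor_surjective _) ?_
  · rw [← LinearMap.ker_eq_bot, Submodule.ker_mapQ, Submodule.mkQ_map_self]
  · intro z
    obtain ⟨z, rfl⟩ := Submodule.mkQ_surjective J z
    constructor
    · intro hz
      have hz' : z ∈ J ⊔ Ideal.span {y} := by
        exact (Submodule.Quotient.mk_eq_zero _).1 hz
      obtain ⟨a, ha, b, hb, rfl⟩ := Submodule.mem_sup.1 hz'
      obtain ⟨c, rfl⟩ := Ideal.mem_span_singleton'.1 hb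
      refine ⟨Submodule.mkQ _ c, ?_⟩
      simp only [Submodule.mkQ_apply, Submodule.mapQ_apply, LinearMap.mulLeft_apply]
      rw [eq_comm, Submodule.Quotient.eq]
      simpa [mul_comm] using ha
    · rintro ⟨w, hw⟩
      obtain ⟨w, rfl⟩ := Submodule.mkQ_surjective _ w
      rw [← hw]
      simp only [Submodule.mkQ_apply, Submodule.mapQ_apply, LinearMap.mulLeft_apply,
        Submodule.factor]
      rw [Submodule.Quotient.mk_eq_zero]
      exact Submodule.mem_sup_right (Ideal.mul_mem_right _ _ (Ideal.mem_span_singleton_self y))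

theorem length_quotient_sup_span_pow_le {R : Type u} [CommRing R] (J : Ideal R) (y : R) (a : ℕ) :
    Module.length R (R ⧸ (J ⊔ Ideal.span {y ^ a})) ≤
      a * Module.length R (R ⧸ (J ⊔ Ideal.span {y})) := by
  induction a with
  | zero =>
    have : Subsingleton (R ⧸ (J ⊔ Ideal.span {y ^ 0})) :=
      Ideal.Quotient.subsingleton_iff.2 (by simp)
    simp [Module.length_eq_zero]
  | succ a ih =>
    rw [length_quotient_eq_add _ y, Nat.cast_succ, add_mul, one_mul]
    refine add_le_add ((length_quotient_anti ?_).trans ih) (length_quotient_anti ?_)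
    · refine sup_le (fun z hz ↦ Submodule.mem_sup_left (J.mul_mem_left y hz)) ?_
      rw [Ideal.span_singleton_le_iff_mem]
      refine Submodule.mem_sup_right ?_
      simp only [LinearMap.mulLeft_apply]
      rw [← pow_succ']
      exact Ideal.mem_span_singleton_self _
    · exact sup_le_sup_right le_sup_left _

theorem length_quotient_sup_span_range_pow_le {R : Type u} [CommRing R] (n : ℕ) {p : ℕ}
    (J : Ideal R) (x : Fin p → R) :
    Module.length R (R ⧸ (J ⊔ Ideal.span (Set.range fun i ↦ x i ^ n))) ≤
      (n ^ p : ℕ) * Module.length R (R ⧸ (J ⊔ Ideal.span (Set.range x))) := by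
  induction p generalizing J with
  | zero => rw [pow_zero, Nat.cast_one, one_mul, Subsingleton.elim (fun i ↦ x i ^ n) x]
  | succ p ih =>
    have key (z : Fin (p + 1) → R) : Ideal.span (Set.range z) =
        Ideal.span {z 0} ⊔ Ideal.span (Set.range fun i : Fin p ↦ z i.succ) := by
      rw [← Ideal.span_union, Fin.range_fin_succ]; rfl
    rw [key, key x, ← sup_assoc]
    refine (ih (J ⊔ Ideal.span {x 0 ^ n}) fun i ↦ x i.succ).trans ?_
    rw [pow_succ, Nat.cast_mul, mul_assoc]
    refine mul_le_mul' le_rfl ?_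
    rw [sup_right_comm J, ← sup_assoc, sup_right_comm J (Ideal.span {x 0})]
    exact length_quotient_sup_span_pow_le _ _ _

theorem length_quotient_pow_le {R : Type u} [CommRing R] {p : ℕ} {I : Ideal R} (x : Fin p → R)
    (hx : ∀ i, x i ∈ I) (n : ℕ) :
    Module.length R (R ⧸ I ^ n) ≤
      (n ^ p : ℕ) * Module.length R (R ⧸ Ideal.span (Set.range x)) := by
  have h := length_quotient_sup_span_range_pow_le n ⊥ x
  rw [bot_sup_eq, bot_sup_eq] at h
  refine (length_quotient_anti ?_).trans h
  rw [Ideal.span_le]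
  rintro _ ⟨i, rfl⟩
  exact Ideal.pow_mem_pow (hx i) n

theorem exists_comap_mulLeft_sup_pow_le {A : Type u} [CommRing A] [IsNoetherianRing A]
    (m p : Ideal A) [p.IsPrime] {x : A} (hx : x ∉ p) :
    ∃ k, ∀ n, Submodule.comap (LinearMap.mulLeft A x) (p ⊔ m ^ (n + k)) ≤ p ⊔ m ^ n := by
  obtain ⟨k, hk⟩ := Ideal.exists_pow_inf_eq_pow_smul m (p ⊔ Ideal.span {x})
  refine ⟨k, fun n a ha ↦ ?_⟩
  obtain ⟨y, hy, z, hz, hyz⟩ := Submodule.mem_sup.1 (show x * a ∈ p ⊔ m ^ (n + k) from ha)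
  have hzJ : z ∈ p ⊔ Ideal.span {x} := by
    rw [← eq_sub_iff_add_eq'] at hyz
    rw [hyz]
    exact sub_mem (Submodule.mem_sup_right
      (Ideal.mul_mem_right _ _ (Ideal.mem_span_singleton_self x))) (Submodule.mem_sup_left hy)
  have hz' : z ∈ m ^ n • (p ⊔ Ideal.span {x}) := by
    have h := hk (n + k) (Nat.le_add_left _ _)
    rw [Nat.add_sub_cancel] at h
    have h' : z ∈ m ^ (n + k) • (⊤ : Ideal A) ⊓ (p ⊔ Ideal.span {x}) := ⟨by simpa using hz, hzJ⟩
    rw [h] at h'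
    exact Submodule.smul_mono le_rfl inf_le_right h'
  rw [smul_eq_mul, Ideal.mul_sup] at hz'
  obtain ⟨u, hu, v, hv, rfl⟩ := Submodule.mem_sup.1 hz'
  rw [mul_comm] at hv
  obtain ⟨b, hb, rfl⟩ := Ideal.mem_span_singleton_mul.1 hv
  have hab : x * (a - b) ∈ p := by
    have : x * (a - b) = y + u := by rw [mul_sub, ← hyz]; ring
    rw [this]
    exact add_mem hy (Ideal.mul_le_right (I := m ^ n) hu)
  have := (Ideal.IsPrime.mem_or_mem ‹_› hab).resolve_left hx
  rw [← sub_add_cancel a b]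
  exact Submodule.add_mem_sup this hb

/-- Lengths of the quotients of a local ring by powers of its maximal ideal bound the
Krull dimension: the induction over chains of primes. -/
theorem ltSeries_length_le_of_length_quotient_le {A : Type u} [CommRing A] [IsNoetherianRing A]
    [IsLocalRing A] (d : ℕ) (I : Ideal A) (C : ℕ)
    (hC : ∀ n, Module.length A (A ⧸ (I ⊔ IsLocalRing.maximalIdeal A ^ n)) ≤
      (C * (n + 1) ^ d : ℕ)) (l : LTSeries (PrimeSpectrum A)) (hl : I ≤ l.head.asIdeal) :
    l.length ≤ d := by
  induction d generalizing I C l with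
  | zero | succ d ih
  all_goals
    by_contra! hlen
    obtain ⟨x, hx1, hx0⟩ : ∃ x ∈ (l ⟨1, by lia⟩).asIdeal, x ∉ l.head.asIdeal :=
      SetLike.exists_of_lt (PrimeSpectrum.asIdeal_lt_asIdeal _ _ |>.2
        (l.strictMono (show (0 : Fin (l.length + 1)) < ⟨1, by lia⟩ by simp [Fin.lt_def])))
    set p := l.head.asIdeal
    obtain ⟨k, hk⟩ := exists_comap_mulLeft_sup_pow_le (IsLocalRing.maximalIdeal A) p hx0
    have step (a n : ℕ) : a * Module.length A
        (A ⧸ ((p ⊔ Ideal.span {x}) ⊔ IsLocalRing.maximalIdeal A ^ n)) ≤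
        Module.length A (A ⧸ (p ⊔ IsLocalRing.maximalIdeal A ^ (n + a * k))) := by
      induction a with
      | zero => simp
      | succ a iha =>
        rw [length_quotient_eq_add (p ⊔ _) x, Nat.cast_succ, add_mul, one_mul, add_one_mul a k,
          ← add_assoc]
        refine add_le_add (iha.trans (length_quotient_anti (hk _))) (length_quotient_anti ?_)
        rw [sup_right_comm]
        exact sup_le_sup_left (Ideal.pow_le_pow_right (by lia)) _
    have bound (a n : ℕ) : a * Module.length A
        (A ⧸ ((p ⊔ Ideal.span {x}) ⊔ IsLocalRing.maximalIdeal A ^ n)) ≤ _ :=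
      (step a n).trans ((length_quotient_anti (sup_le_sup_right hl _)).trans (hC _))
  · have h1 : 1 ≤ Module.length A
        (A ⧸ ((p ⊔ Ideal.span {x}) ⊔ IsLocalRing.maximalIdeal A ^ 1)) := by
      rw [Order.one_le_iff_pos, Module.length_pos_iff, Ideal.Quotient.nontrivial_iff]
      refine ne_top_of_le_ne_top (IsLocalRing.maximalIdeal.isMaximal A).ne_top
        (sup_le (sup_le ?_ ?_) (pow_one _).le)
      · exact IsLocalRing.le_maximalIdeal l.head.isPrime.ne_top
      · rw [Ideal.span_singleton_le_iff_mem]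
        exact IsLocalRing.le_maximalIdeal (l ⟨1, by lia⟩).isPrime.ne_top hx1
    have h2 := (mul_le_mul_right h1 ((C + 1 : ℕ) : ℕ∞)).trans (bound (C + 1) 1)
    rw [mul_one, pow_zero, mul_one] at h2
    norm_cast at h2
    lia
  · have h3 := ih (p ⊔ Ideal.span {x}) (C * (k + 1) ^ (d + 1)) (fun n ↦ ?_)
      (l.tail (by lia)) ?_
    · rw [RelSeries.tail_length] at h3
      lia
    · have h4 := bound (n + 1) n
      rw [show C * (n + (n + 1) * k + 1) ^ (d + 1) =
        (n + 1) * (C * (k + 1) ^ (d + 1) * (n + 1) ^ d) by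
          rw [show n + (n + 1) * k + 1 = (n + 1) * (k + 1) by ring, mul_pow]; ring, Nat.cast_mul] at h4
      exact (ENat.mul_le_mul_left_iff (by simp) (by simp)).1 h4
    · rw [RelSeries.head_tail]
      refine sup_le (l.strictMono.monotone (Fin.zero_le _)) ?_
      rw [Ideal.span_singleton_le_iff_mem]
      convert hx1 using 3
      exact Fin.ext (Nat.mod_eq_of_lt (by lia))

theorem ringKrullDim_le_of_length_quotient_le {A : Type u} [CommRing A] [IsNoetherianRing A]
    [IsLocalRing A] (d C : ℕ)
    (hC : ∀ n, Module.length A (A ⧸ IsLocalRing.maximalIdeal A ^ n) ≤ (C * (n + 1) ^ d : ℕ)) :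
    ringKrullDim A ≤ d := by
  refine iSup_le fun l ↦ ?_
  exact_mod_cast ltSeries_length_le_of_length_quotient_le d ⊥ C
    (fun n ↦ by rw [bot_sup_eq]; exact hC n) l bot_le

theorem finrank_eq_sum_of_forall_existsUnique {k V : Type*} [Field k] [AddCommGroup V] [Module k V]
    {N : ℕ} (W : Fin N → Submodule k V) [∀ i, Module.Finite k (W i)] (M : Submodule k V)
    (hinj : ∀ v : ∀ i, W i, ∑ i, (v i : V) = 0 → v = 0)
    (hM : ∀ x, x ∈ M ↔ ∃ v : ∀ i, W i, ∑ i, (v i : V) = x) :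
    Module.finrank k M = ∑ i, Module.finrank k (W i) := by
  let Ψ : (∀ i, W i) →ₗ[k] V := ∑ i, (W i).subtype ∘ₗ LinearMap.proj i
  have hΨ (v) : Ψ v = ∑ i, (v i : V) := by simp [Ψ]
  have hrange : LinearMap.range Ψ = M := by
    ext x
    simp [hM, hΨ]
  rw [← hrange, LinearMap.finrank_range_of_inj, Module.finrank_pi_fintype]
  rw [← LinearMap.ker_eq_bot, LinearMap.ker_eq_bot']
  intro v hv
  exact hinj v (by rw [← hΨ, hv])

section AssociatedGraded

open MvPolynomial

variable {R : Type u} [CommRing R] (I : Ideal R)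

/-- The associated graded ring of an ideal `I`, as the quotient of the Rees algebra by `I`. -/
abbrev AssocGraded :=
  (reesAlgebra I) ⧸ Ideal.map (algebraMap R (reesAlgebra I)) I

variable {I}

theorem coeff_mem_of_mem_map_reesAlgebra {f : reesAlgebra I}
    (hf : f ∈ Ideal.map (algebraMap R (reesAlgebra I)) I) (n : ℕ) :
    (f : Polynomial R).coeff n ∈ I ^ (n + 1) := by
  induction hf using Submodule.span_induction generalizing n with
  | mem x hx =>
    obtain ⟨a, ha, rfl⟩ := hx
    rw [show ((algebraMap R (reesAlgebra I) a : reesAlgebra I) : Polynomial R) =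
      Polynomial.C a from rfl, Polynomial.coeff_C]
    split_ifs with h
    · simpa [h] using ha
    · exact zero_mem _
  | zero => simp
  | add x y _ _ hx hy => simpa using add_mem (hx n) (hy n)
  | smul a x _ hx =>
    rw [smul_eq_mul, MulMemClass.coe_mul, Polynomial.coeff_mul]
    refine sum_mem fun ij hij ↦ ?_
    rw [← Finset.HasAntidiagonal.mem_antidiagonal.1 hij, add_assoc, pow_add]
    exact Ideal.mul_mem_mul ((mem_reesAlgebra_iff _ _).1 a.2 _) (hx _)

theorem monomial_mem_map_reesAlgebra {n : ℕ} {a : R} (ha' : a ∈ I ^ (n + 1)) :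
    ∃ h : a ∈ I ^ n, (⟨Polynomial.monomial n a, reesAlgebra.monomial_mem.2 h⟩ :
      reesAlgebra I) ∈ Ideal.map (algebraMap R (reesAlgebra I)) I := by
  rw [pow_succ'] at ha'
  induction ha' using Submodule.mul_induction_on' with
  | mem_mul_mem b hb c hc =>
    refine ⟨Ideal.mul_mem_left _ _ hc, ?_⟩
    have h := Ideal.mul_mem_right
      (⟨Polynomial.monomial n c, reesAlgebra.monomial_mem.2 hc⟩ : reesAlgebra I) _
      (Ideal.mem_map_of_mem (algebraMap R (reesAlgebra I)) hb)
    rwa [show algebraMap R (reesAlgebra I) b *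
      (⟨Polynomial.monomial n c, reesAlgebra.monomial_mem.2 hc⟩ : reesAlgebra I) =
      ⟨Polynomial.monomial n (b * c), reesAlgebra.monomial_mem.2 (Ideal.mul_mem_left _ _ hc)⟩
      from Subtype.ext Polynomial.C_mul_monomial] at h
  | add x hx y hy h1 h2 =>
    obtain ⟨h1, h1'⟩ := h1
    obtain ⟨h2, h2'⟩ := h2
    refine ⟨add_mem h1 h2, ?_⟩
    have h := add_mem h1' h2'
    rwa [show (⟨Polynomial.monomial n x, reesAlgebra.monomial_mem.2 h1⟩ : reesAlgebra I) +
      ⟨Polynomial.monomial n y, reesAlgebra.monomial_mem.2 h2⟩ =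
      ⟨Polynomial.monomial n (x + y), reesAlgebra.monomial_mem.2 (add_mem h1 h2)⟩ from
      Subtype.ext (map_add (Polynomial.monomial n) x y).symm] at h

theorem mem_map_reesAlgebra_iff {f : reesAlgebra I} :
    f ∈ Ideal.map (algebraMap R (reesAlgebra I)) I ↔
      ∀ n, (f : Polynomial R).coeff n ∈ I ^ (n + 1) := by
  refine ⟨coeff_mem_of_mem_map_reesAlgebra, fun hf ↦ ?_⟩
  have : f = ∑ n ∈ (f : Polynomial R).support, ⟨Polynomial.monomial n
      ((f : Polynomial R).coeff n),
      reesAlgebra.monomial_mem.2 ((mem_reesAlgebra_iff _ _).1 f.2 n)⟩ := by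
    ext1
    rw [AddSubmonoidClass.coe_finsetSum]
    exact Polynomial.as_sum_support _
  rw [this]
  exact sum_mem fun n _ ↦ (monomial_mem_map_reesAlgebra (hf n)).2

namespace AssocGraded

variable (I) in
/-- The degree `n` part of the associated graded ring, as the image of `I ^ n`. -/
noncomputable def ofPow (n : ℕ) : ↥(I ^ n) →ₗ[R] AssocGraded I where
  toFun a := Ideal.Quotient.mk _ ⟨Polynomial.monomial n a.1, reesAlgebra.monomial_mem.2 a.2⟩
  map_add' a b := by
    rw [← map_add]
    congr 1
    ext1
    exact map_add _ _ _
  map_smul' r a := by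
    rw [RingHom.id_apply, ← Ideal.Quotient.mkₐ_eq_mk R, ← map_smul]
    congr 1
    ext1
    exact (Polynomial.smul_monomial _ _ _).symm

variable (I) in
/-- The degree `n` coefficient of an element of the associated graded ring. -/
noncomputable def coeff (n : ℕ) : AssocGraded I →ₗ[R] R ⧸ I ^ (n + 1) :=
  Submodule.liftQ
    ((Ideal.map (algebraMap R (reesAlgebra I)) I).restrictScalars R)
    ((Submodule.mkQ (I ^ (n + 1))).comp
      ((Polynomial.lcoeff R n).comp (reesAlgebra I).val.toLinearMap)) (by
    intro f hf
    exact (Submodule.Quotient.mk_eq_zero _).2 (mem_map_reesAlgebra_iff.1 hf n)) ∘ₗ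
  (Submodule.Quotient.restrictScalarsEquiv R
    (Ideal.map (algebraMap R (reesAlgebra I)) I)).symm.toLinearMap

theorem coeff_mk (n : ℕ) (f : reesAlgebra I) :
    coeff I n (Ideal.Quotient.mk _ f) = Ideal.Quotient.mk _ ((f : Polynomial R).coeff n) := rfl

theorem coeff_ofPow_self {n : ℕ} (a : ↥(I ^ n)) :
    coeff I n (ofPow I n a) = Ideal.Quotient.mk _ (a : R) := by
  simp [ofPow, coeff_mk]

theorem coeff_ofPow_of_ne {n j : ℕ} (h : n ≠ j) (a : ↥(I ^ n)) :
    coeff I j (ofPow I n a) = 0 := by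
  simp [ofPow, coeff_mk, Polynomial.coeff_monomial, h]

theorem eq_zero_of_forall_coeff {g : AssocGraded I} (h : ∀ n, coeff I n g = 0) : g = 0 := by
  obtain ⟨f, rfl⟩ := Ideal.Quotient.mk_surjective g
  rw [Ideal.Quotient.eq_zero_iff_mem, mem_map_reesAlgebra_iff]
  intro n
  have := h n
  rwa [coeff_mk, Ideal.Quotient.eq_zero_iff_mem] at this

theorem eq_sum_ofPow (g : AssocGraded I) :
    ∃ (s : Finset ℕ) (a : ∀ n, ↥(I ^ n)), g = ∑ n ∈ s, ofPow I n (a n) := by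
  obtain ⟨f, rfl⟩ := Ideal.Quotient.mk_surjective g
  refine ⟨(f : Polynomial R).support,
    fun n ↦ ⟨(f : Polynomial R).coeff n, (mem_reesAlgebra_iff _ _).1 f.2 n⟩, ?_⟩
  simp only [ofPow, LinearMap.coe_mk, AddHom.coe_mk]
  rw [← map_sum]
  congr 1
  ext1
  rw [AddSubmonoidClass.coe_finsetSum]
  exact Polynomial.as_sum_support _

theorem prod_ofPow_one_pow {s : ℕ} (t : Fin s → I) (d : Fin s →₀ ℕ) :
    ∃ h : ∏ i, (t i : R) ^ d i ∈ I ^ d.degree,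
      ∏ i, ofPow I 1 ⟨t i, by simp⟩ ^ d i = ofPow I d.degree ⟨_, h⟩ := by
  have h : ∏ i, (t i : R) ^ d i ∈ I ^ d.degree := by
    rw [Finsupp.degree_eq_sum, ← Finset.prod_pow_eq_pow_sum]
    exact Ideal.prod_mem_prod fun i _ ↦ Ideal.pow_mem_pow (t i).2 _
  refine ⟨h, ?_⟩
  simp only [ofPow, LinearMap.coe_mk, AddHom.coe_mk]
  simp_rw [← map_pow]
  rw [← map_prod]
  congr 1
  ext1
  simp only [SubmonoidClass.coe_finsetProd, SubmonoidClass.coe_pow, Polynomial.monomial_pow,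
    one_mul]
  rw [Finsupp.degree_eq_sum]
  generalize (Finset.univ : Finset (Fin s)) = S
  induction S using Finset.cons_induction with
  | empty => simp
  | cons i S hi ih => rw [Finset.prod_cons, Finset.prod_cons, Finset.sum_cons, ih,
      Polynomial.monomial_mul_monomial]

variable (k : Type v) [Field k] [Algebra R k] [Algebra k (AssocGraded I)]
  [IsScalarTower R k (AssocGraded I)] {s : ℕ} (t : Fin s → I)

/-- The presentation of the associated graded ring given by elements of `I`. -/
noncomputable def presentation : MvPolynomial (Fin s) k →ₐ[k] AssocGraded I :=
  aeval fun i ↦ ofPow I 1 ⟨t i, by simp⟩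

variable {k}

theorem presentation_monomial (d : Fin s →₀ ℕ) (r : R) :
    ∃ h : r * ∏ i, (t i : R) ^ d i ∈ I ^ d.degree,
      presentation k t (monomial d (algebraMap R k r)) = ofPow I d.degree ⟨_, h⟩ := by
  obtain ⟨h, h'⟩ := prod_ofPow_one_pow t d
  refine ⟨Ideal.mul_mem_left _ _ h, ?_⟩
  rw [presentation, aeval_monomial, Finsupp.prod_fintype _ _ (by simp), h',
    ← IsScalarTower.algebraMap_apply, ← Algebra.smul_def, ← map_smul]
  rfl

theorem presentation_map_of_isHomogeneous {n : ℕ} {q : MvPolynomial (Fin s) R}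
    (hq : q.IsHomogeneous n) :
    ∃ h : eval (fun i ↦ (t i : R)) q ∈ I ^ n,
      presentation k t (map (algebraMap R k) q) = ofPow I n ⟨_, h⟩ := by
  have hmem (d) (hd : d ∈ q.support) : q.coeff d * ∏ i, (t i : R) ^ d i ∈ I ^ n := by
    have hd' : d.degree = n := (hq.degree_eq_sum_deg_support hd).symm
    rw [← hd']
    exact (presentation_monomial (k := k) t d _).1
  have h : eval (fun i ↦ (t i : R)) q ∈ I ^ n := by
    rw [eval_eq']
    exact sum_mem hmem
  refine ⟨h, ?_⟩
  have h2 : (⟨_, h⟩ : ↥(I ^ n)) =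
      ∑ d ∈ q.support.attach, ⟨q.coeff d * ∏ i, (t i : R) ^ d.1 i, hmem d d.2⟩ := by
    ext1
    rw [AddSubmonoidClass.coe_finsetSum]
    simp only [eval_eq']
    exact (Finset.sum_attach q.support fun d ↦ q.coeff d * ∏ i, (t i : R) ^ d i).symm
  rw [h2, map_sum]
  conv_lhs => rw [q.as_sum, ← Finset.sum_attach, map_sum, map_sum]
  refine Finset.sum_congr rfl fun d _ ↦ ?_
  obtain ⟨h3, h4⟩ := presentation_monomial (k := k) t d (q.coeff d)
  rw [map_monomial, h4]
  have : n = d.1.degree := hq.degree_eq_sum_deg_support d.2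
  subst this
  rfl

variable (k) in
/-- The degree `n` part of the associated graded ring, as a vector space over `k`. -/
noncomputable def piece (n : ℕ) : Submodule k (AssocGraded I) :=
  (homogeneousSubmodule (Fin s) k n).map (presentation k t).toLinearMap

instance finite_homogeneousSubmodule (n : ℕ) :
    Module.Finite k (homogeneousSubmodule (Fin s) k n) :=
  Module.Finite.iff_fg.2 (homogeneousSubmodule_fg (Fin s) k n)

instance finite_piece (n : ℕ) : Module.Finite k (piece k t n) :=
  Module.Finite.map _ _

variable (hk : Function.Surjective (algebraMap R k))
  (ht : Ideal.span (Set.range fun i ↦ (t i : R)) = I)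

include hk in
theorem exists_eq_ofPow_of_mem_piece {n : ℕ} {g : AssocGraded I} (hg : g ∈ piece k t n) :
    ∃ a, g = ofPow I n a := by
  obtain ⟨p, hp, rfl⟩ := hg
  obtain ⟨q, rfl⟩ := map_surjective (σ := Fin s) _ hk p
  obtain ⟨h, h'⟩ := presentation_map_of_isHomogeneous (k := k) t
    (homogeneousComponent_isHomogeneous n q)
  refine ⟨⟨_, h⟩, ?_⟩
  rw [← h', AlgHom.toLinearMap_apply]
  congr 1
  rw [← homogeneousComponent_eq_self ((mem_homogeneousSubmodule _ _).1 hp)]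
  ext d
  rw [coeff_homogeneousComponent, coeff_map, coeff_map, coeff_homogeneousComponent]
  split_ifs <;> simp

include ht in
theorem ofPow_mem_piece {n : ℕ} (a : ↥(I ^ n)) : ofPow I n a ∈ piece k t n := by
  obtain ⟨q, hq, hqa⟩ := (Ideal.mem_span_pow_iff_exists_isHomogeneous _ _).1
    (show (a : R) ∈ Ideal.span (Set.range fun i ↦ (t i : R)) ^ n by rw [ht]; exact a.2)
  obtain ⟨h, h'⟩ := presentation_map_of_isHomogeneous (k := k) t hq
  refine ⟨map (algebraMap R k) q, hq.map _, ?_⟩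
  rw [AlgHom.toLinearMap_apply, h']
  congr 1
  exact Subtype.ext hqa

include ht in
theorem presentation_surjective : Function.Surjective (presentation k t) := by
  intro g
  obtain ⟨S, a, rfl⟩ := eq_sum_ofPow g
  choose p hp hp' using fun n ↦ ofPow_mem_piece (k := k) t ht (a n)
  exact ⟨∑ n ∈ S, p n, by rw [map_sum]; exact Finset.sum_congr rfl fun n _ ↦ hp' n⟩

include hk in
theorem coeff_of_mem_piece {n j : ℕ} (h : n ≠ j) {g : AssocGraded I} (hg : g ∈ piece k t n) :
    coeff I j g = 0 := by
  obtain ⟨a, rfl⟩ := exists_eq_ofPow_of_mem_piece t hk hg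
  exact coeff_ofPow_of_ne h a

omit [Algebra R k] [IsScalarTower R k (AssocGraded I)] in
theorem presentation_homogeneousComponent_mem (n : ℕ) (p : MvPolynomial (Fin s) k) :
    presentation k t (homogeneousComponent n p) ∈ piece k t n :=
  ⟨_, homogeneousComponent_mem n p, rfl⟩

include hk in
theorem coeff_presentation (n : ℕ) (p : MvPolynomial (Fin s) k) :
    coeff I n (presentation k t p) =
      coeff I n (presentation k t (homogeneousComponent n p)) := by
  conv_lhs => rw [← sum_homogeneousComponent p, map_sum, map_sum]
  by_cases hn : n ∈ Finset.range (p.totalDegree + 1)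
  · exact Finset.sum_eq_single_of_mem n hn fun j _ hj ↦
      coeff_of_mem_piece t hk hj (presentation_homogeneousComponent_mem t j p)
  · rw [homogeneousComponent_eq_zero n p (by simpa using hn), map_zero, map_zero]
    refine Finset.sum_eq_zero fun j hj ↦ coeff_of_mem_piece t hk ?_
      (presentation_homogeneousComponent_mem t j p)
    rintro rfl
    exact hn hj

include hk in
theorem homogeneousComponent_mem_ker {p : MvPolynomial (Fin s) k}
    (hp : p ∈ RingHom.ker (presentation k t)) (n : ℕ) :
    homogeneousComponent n p ∈ RingHom.ker (presentation k t) := by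
  rw [RingHom.mem_ker] at hp ⊢
  refine eq_zero_of_forall_coeff fun j ↦ ?_
  by_cases h : n = j
  · rw [← h, ← coeff_presentation t hk, hp, map_zero]
  · exact coeff_of_mem_piece t hk h (presentation_homogeneousComponent_mem t n p)

include hk ht in
theorem length_quotient_pow_succ (n : ℕ) :
    Module.length R (R ⧸ I ^ (n + 1)) =
      Module.finrank k (piece k t n) + Module.length R (R ⧸ I ^ n) := by
  rw [← Module.length_eq_finrank, ← Module.length_eq_of_surjective (S := R) hk]
  refine Module.length_eq_add_of_exact
    ((coeff I n).comp ((piece k t n).subtype.restrictScalars R))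
    (Submodule.factor (Ideal.pow_le_pow_right (n.le_succ))) ?_
    (Submodule.factor_surjective _) ?_
  · rw [← LinearMap.ker_eq_bot, LinearMap.ker_eq_bot']
    rintro ⟨g, hg⟩ h
    refine Subtype.ext (eq_zero_of_forall_coeff fun j ↦ ?_)
    by_cases hj : n = j
    · subst hj; exact h
    · exact coeff_of_mem_piece t hk hj hg
  · intro z
    obtain ⟨z, rfl⟩ := Submodule.mkQ_surjective _ z
    constructor
    · intro hz
      have hz' : z ∈ I ^ n := (Submodule.Quotient.mk_eq_zero _).1 hz
      exact ⟨⟨ofPow I n ⟨z, hz'⟩, ofPow_mem_piece t ht _⟩, coeff_ofPow_self _⟩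
    · rintro ⟨⟨g, hg⟩, h⟩
      obtain ⟨a, rfl⟩ := exists_eq_ofPow_of_mem_piece t hk hg
      rw [← h]
      change Submodule.factor _ (coeff I n (ofPow I n a)) = 0
      rw [coeff_ofPow_self]
      exact (Submodule.Quotient.mk_eq_zero _).2 a.2

include hk ht in
theorem length_quotient_pow (n : ℕ) :
    Module.length R (R ⧸ I ^ n) =
      (∑ i ∈ Finset.range n, Module.finrank k (piece k t i) : ℕ) := by
  induction n with
  | zero =>
    have : Subsingleton (R ⧸ I ^ 0) := Ideal.Quotient.subsingleton_iff.2 (by simp)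
    simp [Module.length_eq_zero]
  | succ n ih =>
    rw [length_quotient_pow_succ t hk ht, ih, Finset.sum_range_succ, Nat.cast_add, add_comm]

include hk in
theorem finrank_map_restrictTotalDegree (N : ℕ) :
    Module.finrank k ((restrictTotalDegree (Fin s) k N).map (presentation k t).toLinearMap) =
      ∑ i ∈ Finset.range (N + 1), Module.finrank k (piece k t i) := by
  refine (finrank_eq_sum_of_forall_existsUnique (k := k) (V := AssocGraded I)
    (fun i : Fin (N + 1) ↦ piece k t i) _ ?_ ?_).trans
    (Fin.sum_univ_eq_sum_range (fun i ↦ Module.finrank k (piece k t i)) (N + 1))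
  · intro v hv
    ext j
    refine eq_zero_of_forall_coeff fun n ↦ ?_
    by_cases hj : (j : ℕ) = n
    · have h := congrArg (coeff I n) hv
      rw [map_sum, map_zero, Finset.sum_eq_single_of_mem j (Finset.mem_univ j)] at h
      · exact h
      · intro i _ hi
        refine coeff_of_mem_piece t hk ?_ (v i).2
        rw [← hj]
        exact fun h ↦ hi (Fin.ext h)
    · exact coeff_of_mem_piece t hk hj (v j).2
  · refine fun x ↦ ⟨?_, ?_⟩
    · rintro ⟨p, hp, rfl⟩
      have hp' := (mem_restrictTotalDegree _ _ _).1 hp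
      refine ⟨fun i ↦ ⟨_, presentation_homogeneousComponent_mem t i p⟩, ?_⟩
      rw [AlgHom.toLinearMap_apply,
        Fin.sum_univ_eq_sum_range (fun i ↦ presentation k t (homogeneousComponent i p)),
        ← map_sum]
      conv_rhs => rw [← sum_homogeneousComponent p]
      refine congrArg (presentation k t) ?_
      refine (Finset.sum_subset (Finset.range_mono (by omega)) fun i _ hi ↦ ?_).symm
      exact homogeneousComponent_eq_zero i p (by simpa using hi)
    · rintro ⟨v, rfl⟩
      refine sum_mem fun i _ ↦ ?_
      obtain ⟨p, hp, hp'⟩ := (v i).2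
      rw [← hp']
      refine Submodule.mem_map_of_mem ((mem_restrictTotalDegree _ _ _).2 ?_)
      exact (IsHomogeneous.totalDegree_le hp).trans (Nat.lt_succ_iff.1 i.2)

end AssocGraded

end AssociatedGraded

section CompleteNoetherian

variable {A : Type u} [CommRing A] {I : Ideal A}

namespace AssocGraded

theorem exists_coeff_mul_ofPow (g : AssocGraded I) (n m : ℕ) (a : ↥(I ^ m)) :
    ∃ c ∈ I ^ (n - m), coeff I n (g * ofPow I m a) = Ideal.Quotient.mk _ (c * (a : A)) := by
  obtain ⟨f, rfl⟩ := Ideal.Quotient.mk_surjective g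
  have h : Ideal.Quotient.mk _ f * ofPow I m a = Ideal.Quotient.mk _
    (f * (⟨Polynomial.monomial m a.1, reesAlgebra.monomial_mem.2 a.2⟩ : reesAlgebra I)) := rfl
  rw [h, coeff_mk, MulMemClass.coe_mul]
  change ∃ c ∈ I ^ (n - m), Ideal.Quotient.mk _
    (((f : Polynomial A) * Polynomial.monomial m (a : A)).coeff n) = _
  by_cases hm : m ≤ n
  · refine ⟨(f : Polynomial A).coeff (n - m), (mem_reesAlgebra_iff _ _).1 f.2 _, ?_⟩
    obtain ⟨l, rfl⟩ := Nat.exists_eq_add_of_le' hm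
    rw [Polynomial.coeff_mul_monomial, Nat.add_sub_cancel]
  · refine ⟨0, zero_mem _, ?_⟩
    rw [zero_mul, ← Polynomial.C_mul_X_pow_eq_monomial, ← mul_assoc, Polynomial.coeff_mul_X_pow',
      if_neg hm]

/-- A standard basis of an ideal `J`, with respect to the `I`-adic filtration. -/
theorem exists_standardBasis [IsNoetherianRing (AssocGraded I)] (J : Ideal A) :
    ∃ (r : ℕ) (a : Fin r → A) (d : Fin r → ℕ), (∀ j, a j ∈ J) ∧
      ∀ n, ∀ b ∈ J, b ∈ I ^ n → ∃ c : Fin r → A, (∀ j, c j ∈ I ^ (n - d j)) ∧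
        b - ∑ j, c j * a j ∈ I ^ (n + 1) := by
  let S : Set (AssocGraded I) := {g | ∃ n, ∃ a : ↥(I ^ n), (a : A) ∈ J ∧ ofPow I n a = g}
  obtain ⟨T, hTS, hT⟩ := (Submodule.fg_span_iff_fg_span_finset_subset (R := AssocGraded I) S).1
    (IsNoetherian.noetherian _)
  have hmem (j : Fin T.card) : (T.equivFin.symm j : AssocGraded I) ∈ S :=
    hTS (T.equivFin.symm j).2
  choose d a haJ ha using hmem
  refine ⟨T.card, fun j ↦ a j, d, haJ, fun n b hbJ hb ↦ ?_⟩
  have hrange : (T : Set (AssocGraded I)) = Set.range fun j ↦ ofPow I (d j) (a j) := by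
    simp_rw [ha]
    ext x
    constructor
    · exact fun hx ↦ ⟨T.equivFin ⟨x, hx⟩, by simp⟩
    · rintro ⟨j, rfl⟩
      exact (T.equivFin.symm j).2
  have hbT : ofPow I n ⟨b, hb⟩ ∈ Submodule.span (AssocGraded I) S :=
    Submodule.subset_span ⟨n, _, hbJ, rfl⟩
  rw [hT, hrange] at hbT
  obtain ⟨g, hg⟩ := (Submodule.mem_span_range_iff_exists_fun _).1 hbT
  choose c hc hc' using fun j ↦ exists_coeff_mul_ofPow (g j) n (d j) (a j)
  refine ⟨c, hc, ?_⟩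
  rw [← Ideal.Quotient.eq_zero_iff_mem, map_sub, map_sum, ← coeff_ofPow_self ⟨b, hb⟩, ← hg,
    map_sum, sub_eq_zero]
  exact Finset.sum_congr rfl fun j _ ↦ hc' j

end AssocGraded

open AssocGraded in
/-- An adically complete ring is Noetherian if its associated graded ring is. -/
theorem isNoetherianRing_of_isAdicComplete [IsNoetherianRing (AssocGraded I)]
    [IsAdicComplete I A] : IsNoetherianRing A := by
  refine (isNoetherianRing_iff_ideal_fg A).2 fun J ↦ ?_
  obtain ⟨r, a, d, haJ, hstep⟩ := exists_standardBasis (I := I) J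
  suffices J = Ideal.span (Set.range a) by
    rw [this]
    exact (Submodule.fg_span (Set.finite_range a))
  refine le_antisymm (fun b hb ↦ ?_) (Ideal.span_le.2 (Set.range_subset_iff.2 haJ))
  have hstep' (n : ℕ) (b : A) : ∃ c : Fin r → A, (∀ j, c j ∈ I ^ (n - d j)) ∧
      (b ∈ J → b ∈ I ^ n → b - ∑ j, c j * a j ∈ I ^ (n + 1)) := by
    by_cases h : b ∈ J ∧ b ∈ I ^ n
    · obtain ⟨c, hc, hc'⟩ := hstep n b h.1 h.2
      exact ⟨c, hc, fun _ _ ↦ hc'⟩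
    · exact ⟨0, fun _ ↦ zero_mem _, fun h1 h2 ↦ (h ⟨h1, h2⟩).elim⟩
  choose c hc hc' using hstep'
  let β : ℕ → A := fun n ↦ n.rec b fun n x ↦ x - ∑ j, c n x j * a j
  have hβ (n : ℕ) : β (n + 1) = β n - ∑ j, c n (β n) j * a j := rfl
  have hβmem (n : ℕ) : β n ∈ J ∧ β n ∈ I ^ n := by
    induction n with
    | zero => exact ⟨hb, by simp⟩
    | succ n ih =>
      refine ⟨?_, hc' n _ ih.1 ih.2⟩
      rw [hβ]
      exact sub_mem ih.1 (sum_mem fun j _ ↦ Ideal.mul_mem_left _ _ (haJ j))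
  let σ (j : Fin r) (n : ℕ) : A := ∑ i ∈ Finset.range n, c i (β i) j
  have hσ (n : ℕ) : b = β n + ∑ j, σ j n * a j := by
    induction n with
    | zero => simp [σ, β]
    | succ n ih =>
      simp only [σ, Finset.sum_range_succ, add_mul, Finset.sum_add_distrib] at ih ⊢
      rw [hβ]
      linear_combination ih
  let N := Finset.univ.sup d
  have hlim (j : Fin r) : ∃ L, ∀ n, σ j (n + N) - L ∈ I ^ n := by
    obtain ⟨L, hL⟩ := IsPrecomplete.prec (I := I) (M := A) inferInstance
      (f := fun n ↦ σ j (n + N)) (by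
        intro m n hmn
        rw [SModEq.sub_mem, smul_eq_mul, Ideal.mul_top]
        induction n, hmn using Nat.le_induction with
        | base => simp
        | succ n hmn ih =>
          have h1 : σ j (n + 1 + N) = σ j (n + N) + c (n + N) (β (n + N)) j := by
            rw [add_right_comm]
            exact Finset.sum_range_succ _ _
          rw [h1, ← sub_sub]
          refine sub_mem ih (Ideal.pow_le_pow_right ?_ (hc (n + N) _ j))
          have := Finset.le_sup (f := d) (Finset.mem_univ j)
          change d j ≤ N at this
          omega)
    refine ⟨L, fun n ↦ ?_⟩
    have := hL n
    rwa [SModEq.sub_mem, smul_eq_mul, Ideal.mul_top] at this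
  choose L hL using hlim
  have hb' : b - ∑ j, L j * a j = 0 := by
    refine IsHausdorff.haus (I := I) inferInstance _ fun n ↦ ?_
    rw [SModEq.zero, smul_eq_mul, Ideal.mul_top]
    have h1 : b - ∑ j, L j * a j = β (n + N) + ∑ j, (σ j (n + N) - L j) * a j := by
      simp only [sub_mul, Finset.sum_sub_distrib]
      linear_combination hσ (n + N)
    rw [h1]
    exact add_mem (Ideal.pow_le_pow_right (Nat.le_add_right _ _) (hβmem _).2)
      (sum_mem fun j _ ↦ Ideal.mul_mem_right _ _ (hL j n))
  rw [sub_eq_zero.1 hb']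
  exact sum_mem fun j _ ↦ Ideal.mul_mem_left _ _ (Ideal.subset_span ⟨j, rfl⟩)

end CompleteNoetherian

section HilbertSeries

open MvPolynomial

variable {k : Type v} [Field k] {s : ℕ}

/-- The degree `n` part of an ideal of a polynomial ring. -/
noncomputable def idealPiece (I : Ideal (MvPolynomial (Fin s) k)) (n : ℕ) :
    Submodule k (MvPolynomial (Fin s) k) :=
  I.restrictScalars k ⊓ homogeneousSubmodule (Fin s) k n

theorem mem_idealPiece {I : Ideal (MvPolynomial (Fin s) k)} {n : ℕ} {p : MvPolynomial (Fin s) k} :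
    p ∈ idealPiece I n ↔ p ∈ I ∧ p.IsHomogeneous n := Iff.rfl

instance finite_idealPiece (I : Ideal (MvPolynomial (Fin s) k)) (n : ℕ) :
    Module.Finite k (idealPiece I n) :=
  have : Module.Finite k (homogeneousSubmodule (Fin s) k n) :=
    Module.Finite.iff_fg.2 (homogeneousSubmodule_fg (Fin s) k n)
  Submodule.finiteDimensional_of_le (inf_le_right : idealPiece I n ≤ homogeneousSubmodule _ _ n)

/-- The difference of the Hilbert series of two ideals of a polynomial ring. -/
noncomputable def hilbertSeriesSub (I J : Ideal (MvPolynomial (Fin s) k)) : PowerSeries ℚ :=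
  PowerSeries.mk fun n ↦ (Module.finrank k (idealPiece I n) : ℚ) - Module.finrank k (idealPiece J n)

theorem homogeneousComponent_succ_X_mul (n : ℕ) (i : Fin s) (p : MvPolynomial (Fin s) k) :
    homogeneousComponent (n + 1) (X i * p) = X i * homogeneousComponent n p := by
  ext d
  simp only [coeff_homogeneousComponent, coeff_X_mul']
  by_cases hi : i ∈ d.support
  · have h1 : (d - Finsupp.single i 1).degree + 1 = d.degree := by
      have h := tsub_add_cancel_of_le (Finsupp.single_le_iff.2
        (Nat.one_le_iff_ne_zero.2 (Finsupp.mem_support_iff.1 hi)) : Finsupp.single i 1 ≤ d)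
      conv_rhs => rw [← h, map_add, Finsupp.degree_single]
    simp only [hi, if_true, ← h1, Nat.add_right_cancel_iff]
  · simp [hi]

theorem homogeneousComponent_zero_X_mul (i : Fin s) (p : MvPolynomial (Fin s) k) :
    homogeneousComponent 0 (X i * p) = 0 := by
  rw [homogeneousComponent_zero, coeff_X_mul', if_neg (by simp), map_zero]

/-- Ideals of a polynomial ring that are closed under taking homogeneous components. -/
def IsHomogeneousIdeal (I : Ideal (MvPolynomial (Fin s) k)) : Prop :=
  ∀ p ∈ I, ∀ n, homogeneousComponent n p ∈ I

theorem IsHomogeneousIdeal.comap_mulLeft {I J : Ideal (MvPolynomial (Fin s) k)}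
    (hI : IsHomogeneousIdeal I) (hJ : IsHomogeneousIdeal J) (i : Fin s) :
    IsHomogeneousIdeal (I ⊓ Submodule.comap (LinearMap.mulLeft _ (X i)) J) := by
  refine fun p hp n ↦ ⟨hI p hp.1 n, ?_⟩
  have h := hJ _ hp.2 (n + 1)
  rwa [LinearMap.mulLeft_apply, homogeneousComponent_succ_X_mul] at h

theorem IsHomogeneousIdeal.sup_map_mulLeft {I J : Ideal (MvPolynomial (Fin s) k)}
    (hI : IsHomogeneousIdeal I) (hJ : IsHomogeneousIdeal J) (i : Fin s) :
    IsHomogeneousIdeal (J ⊔ Submodule.map (LinearMap.mulLeft _ (X i)) I) := by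
  intro p hp n
  obtain ⟨a, ha, _, ⟨b, hb, rfl⟩, rfl⟩ := Submodule.mem_sup.1 hp
  rw [map_add, LinearMap.mulLeft_apply]
  refine Submodule.add_mem_sup (hJ _ ha n) ?_
  cases n with
  | zero => rw [homogeneousComponent_zero_X_mul]; exact zero_mem _
  | succ n =>
    rw [homogeneousComponent_succ_X_mul]
    exact ⟨_, hI _ hb n, rfl⟩

theorem idealPiece_zero_sup_map_mulLeft {I J : Ideal (MvPolynomial (Fin s) k)} (i : Fin s)
    (hJ : IsHomogeneousIdeal J) :
    idealPiece (J ⊔ Submodule.map (LinearMap.mulLeft _ (X i)) I) 0 = idealPiece J 0 := by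
  ext p
  simp only [mem_idealPiece]
  refine ⟨fun ⟨h, h'⟩ ↦ ⟨?_, h'⟩, fun ⟨h, h'⟩ ↦ ⟨Submodule.mem_sup_left h, h'⟩⟩
  obtain ⟨a, ha, _, ⟨b, hb, rfl⟩, rfl⟩ := Submodule.mem_sup.1 h
  rw [← homogeneousComponent_eq_self h', map_add, LinearMap.mulLeft_apply,
    homogeneousComponent_zero_X_mul, add_zero]
  exact hJ _ ha 0

theorem finrank_idealPiece_succ {I J : Ideal (MvPolynomial (Fin s) k)} (i : Fin s)
    (hI : IsHomogeneousIdeal I) (hJ : IsHomogeneousIdeal J) (n : ℕ) :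
    Module.finrank k (idealPiece (J ⊔ Submodule.map (LinearMap.mulLeft _ (X i)) I) (n + 1)) +
      Module.finrank k
        (idealPiece (I ⊓ Submodule.comap (LinearMap.mulLeft _ (X i)) J) n) =
    Module.finrank k (idealPiece I n) + Module.finrank k (idealPiece J (n + 1)) := by
  let μ : MvPolynomial (Fin s) k →ₗ[k] MvPolynomial (Fin s) k := LinearMap.mulLeft k (X i)
  have hμ : Function.Injective μ := fun a b h ↦ mul_left_cancel₀ (X_ne_zero i) h
  have hhom {p : MvPolynomial (Fin s) k} (hp : p.IsHomogeneous n) :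
      (X i * p).IsHomogeneous (n + 1) := by
    rw [add_comm]
    exact (isHomogeneous_X k i).mul hp
  have h1 : idealPiece (J ⊔ Submodule.map (LinearMap.mulLeft _ (X i)) I) (n + 1) =
      (idealPiece I n).map μ ⊔ idealPiece J (n + 1) := by
    apply le_antisymm
    · rintro p ⟨hp, hp'⟩
      obtain ⟨a, ha, _, ⟨b, hb, rfl⟩, rfl⟩ := Submodule.mem_sup.1 hp
      rw [← homogeneousComponent_eq_self hp', map_add, LinearMap.mulLeft_apply,
        homogeneousComponent_succ_X_mul, add_comm (homogeneousComponent _ a)]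
      exact Submodule.add_mem_sup
        ⟨_, ⟨hI _ hb n, homogeneousComponent_isHomogeneous _ _⟩, rfl⟩
        ⟨hJ _ ha _, homogeneousComponent_isHomogeneous _ _⟩
    · refine sup_le ?_ fun p hp ↦ ⟨Submodule.mem_sup_left hp.1, hp.2⟩
      rintro _ ⟨p, hp, rfl⟩
      exact ⟨Submodule.mem_sup_right ⟨p, hp.1, rfl⟩, hhom hp.2⟩
  have h2 : (idealPiece (I ⊓ Submodule.comap (LinearMap.mulLeft _ (X i)) J) n).map μ =
      (idealPiece I n).map μ ⊓ idealPiece J (n + 1) := by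
    apply le_antisymm
    · rintro _ ⟨p, hp, rfl⟩
      exact ⟨⟨p, ⟨hp.1.1, hp.2⟩, rfl⟩, hp.1.2, hhom hp.2⟩
    · rintro _ ⟨⟨p, hp, rfl⟩, hp'⟩
      exact ⟨p, ⟨⟨hp.1, hp'.1⟩, hp.2⟩, rfl⟩
  rw [h1, (Submodule.equivMapOfInjective μ hμ (idealPiece (I ⊓ _) n)).finrank_eq, h2,
    Submodule.finrank_sup_add_finrank_inf_eq,
    (Submodule.equivMapOfInjective μ hμ (idealPiece I n)).finrank_eq]

theorem one_sub_X_mul_hilbertSeriesSub {I J : Ideal (MvPolynomial (Fin s) k)} (i : Fin s)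
    (hI : IsHomogeneousIdeal I) (hJ : IsHomogeneousIdeal J) :
    (1 - PowerSeries.X) * hilbertSeriesSub I J =
      hilbertSeriesSub I (J ⊔ Submodule.map (LinearMap.mulLeft _ (X i)) I) -
        PowerSeries.X *
          hilbertSeriesSub (I ⊓ Submodule.comap (LinearMap.mulLeft _ (X i)) J) J := by
  ext n
  rw [sub_mul, one_mul, map_sub, map_sub]
  cases n with
  | zero =>
    rw [PowerSeries.coeff_zero_X_mul, PowerSeries.coeff_zero_X_mul]
    simp only [hilbertSeriesSub, PowerSeries.coeff_mk]
    rw [idealPiece_zero_sup_map_mulLeft i hJ]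
  | succ n =>
    rw [PowerSeries.coeff_succ_X_mul, PowerSeries.coeff_succ_X_mul]
    simp only [hilbertSeriesSub, PowerSeries.coeff_mk]
    have h := congrArg (Nat.cast (R := ℚ)) (finrank_idealPiece_succ i hI hJ n)
    push_cast at h
    linarith

theorem exists_forall_idealPiece_eq {I J : Ideal (MvPolynomial (Fin s) k)} (hIJ : J ≤ I)
    (hJ : IsHomogeneousIdeal J) (h : ∀ i, ∀ p ∈ I, X i * p ∈ J) :
    ∃ N, ∀ n, N ≤ n → idealPiece I n = idealPiece J n := by
  obtain ⟨T, rfl⟩ : I.FG := IsNoetherian.noetherian I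
  have key (n : ℕ) (hn : T.sup totalDegree + 1 ≤ n) (p) (hp : p ∈ Ideal.span (T : Set _)) :
      homogeneousComponent n p ∈ J := by
    induction hp using Submodule.span_induction with
    | mem p hp =>
      rw [homogeneousComponent_eq_zero]
      · exact zero_mem _
      · exact (Finset.le_sup (f := totalDegree) hp).trans_lt hn
    | zero => simp
    | add p q _ _ hp hq => rw [map_add]; exact add_mem hp hq
    | smul c p hp hp' =>
      rw [smul_eq_mul]
      induction c using MvPolynomial.induction_on with
      | C a => rw [homogeneousComponent_C_mul]; exact Ideal.mul_mem_left _ _ hp'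
      | add c d hc hd => rw [add_mul, map_add]; exact add_mem hc hd
      | mul_X c i _ =>
        rw [mul_assoc]
        exact hJ _ (Ideal.mul_mem_left _ _ (h i p hp)) n
  refine ⟨T.sup totalDegree + 1, fun n hn ↦ le_antisymm (fun p hp ↦ ⟨?_, hp.2⟩) fun p hp ↦ ⟨hIJ hp.1, hp.2⟩⟩
  have := key n hn p hp.1
  rwa [homogeneousComponent_eq_self hp.2] at this

theorem exists_one_sub_X_pow_mul_hilbertSeriesSub (S : Finset (Fin s))
    (I J : Ideal (MvPolynomial (Fin s) k)) (hIJ : J ≤ I) (hI : IsHomogeneousIdeal I)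
    (hJ : IsHomogeneousIdeal J) (h : ∀ i ∉ S, ∀ p ∈ I, X i * p ∈ J) :
    ∃ q : Polynomial ℚ,
      (1 - PowerSeries.X : PowerSeries ℚ) ^ S.card * hilbertSeriesSub I J = (q : PowerSeries ℚ) := by
  induction S using Finset.cons_induction generalizing I J with
  | empty =>
    obtain ⟨N, hN⟩ := exists_forall_idealPiece_eq hIJ hJ fun i ↦ h i (Finset.notMem_empty i)
    refine ⟨PowerSeries.trunc N (hilbertSeriesSub I J), ?_⟩
    rw [Finset.card_empty, pow_zero, one_mul]
    ext n
    rw [Polynomial.coeff_coe, PowerSeries.coeff_trunc]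
    split_ifs with hn
    · rfl
    · rw [hilbertSeriesSub, PowerSeries.coeff_mk, hN n (not_lt.1 hn), sub_self]
  | cons i S hi ih =>
    obtain ⟨q₁, hq₁⟩ := ih I (J ⊔ Submodule.map (LinearMap.mulLeft _ (X i)) I)
      (sup_le hIJ (by
        rintro _ ⟨p, hp, rfl⟩
        exact Ideal.mul_mem_left _ _ hp)) hI (hI.sup_map_mulLeft hJ i) (by
      intro j hj p hp
      by_cases hji : j = i
      · exact Submodule.mem_sup_right ⟨p, hp, by rw [hji]; rfl⟩
      · exact Submodule.mem_sup_left (h j (by simp [hji, hj]) p hp))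
    obtain ⟨q₂, hq₂⟩ := ih (I ⊓ Submodule.comap (LinearMap.mulLeft _ (X i)) J) J
      (le_inf hIJ fun p hp ↦ Ideal.mul_mem_left _ _ hp) (hI.comap_mulLeft hJ i) hJ (by
      intro j hj p hp
      by_cases hji : j = i
      · rw [hji]; exact hp.2
      · exact h j (by simp [hji, hj]) p hp.1)
    refine ⟨q₁ - Polynomial.X * q₂, ?_⟩
    rw [Finset.card_cons, pow_succ, mul_assoc, one_sub_X_mul_hilbertSeriesSub i hI hJ, mul_sub,
      hq₁, mul_left_comm, hq₂]
    simp

/-- The sums of the first values of the Hilbert function of a quotient of a polynomial ring by a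
homogeneous ideal are eventually given by a polynomial. -/
theorem exists_polynomial_eval_eq_sum_finrank {V : Type*} [AddCommGroup V] [Module k V]
    (φ : MvPolynomial (Fin s) k →ₗ[k] V) (J : Ideal (MvPolynomial (Fin s) k))
    (hφ : LinearMap.ker φ = J.restrictScalars k) (hJ : IsHomogeneousIdeal J) :
    ∃ HS : Polynomial ℚ, ∀ᶠ n : ℕ in Filter.atTop, HS.eval (n : ℚ) =
      (∑ i ∈ Finset.range n, Module.finrank k ((homogeneousSubmodule (Fin s) k i).map φ) : ℕ) := by
  obtain ⟨q, hq⟩ := exists_one_sub_X_pow_mul_hilbertSeriesSub Finset.univ ⊤ J le_top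
    (fun _ _ _ ↦ Submodule.mem_top) hJ (fun i hi ↦ absurd (Finset.mem_univ i) hi)
  have hrank (n : ℕ) : (Module.finrank k ((homogeneousSubmodule (Fin s) k n).map φ) : ℚ) =
      Module.finrank k (idealPiece (⊤ : Ideal (MvPolynomial (Fin s) k)) n) -
        Module.finrank k (idealPiece J n) := by
    have hfin : Module.Finite k (homogeneousSubmodule (Fin s) k n) :=
      Module.Finite.iff_fg.2 (homogeneousSubmodule_fg (Fin s) k n)
    have h := LinearMap.finrank_range_add_finrank_ker (φ.domRestrict (homogeneousSubmodule _ _ n))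
    rw [LinearMap.range_domRestrict, LinearMap.ker_domRestrict, hφ] at h
    have h1 : Module.finrank k ((J.restrictScalars k).submoduleOf
        (homogeneousSubmodule (Fin s) k n)) = Module.finrank k (idealPiece J n) := by
      rw [idealPiece, inf_comm]
      exact (Submodule.finrank_map_subtype_eq _ _).symm.trans
        (by rw [Submodule.submoduleOf, Submodule.map_comap_subtype])
    have h2 : idealPiece (⊤ : Ideal (MvPolynomial (Fin s) k)) n =
      homogeneousSubmodule (Fin s) k n := by
      ext p
      simp [mem_idealPiece]
    rw [h2, ← h]
    push_cast
    rw [← h1]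
    exact (add_sub_cancel_right _ _).symm
  set F : ℕ → ℕ := fun n ↦ ∑ i ∈ Finset.range n,
    Module.finrank k ((homogeneousSubmodule (Fin s) k i).map φ) with hF
  have hser : (1 - PowerSeries.X) * PowerSeries.mk (fun n ↦ (F n : ℚ)) =
      PowerSeries.X * hilbertSeriesSub ⊤ J := by
    ext n
    rw [sub_mul, one_mul, map_sub]
    cases n with
    | zero => simp [hF]
    | succ n =>
      rw [PowerSeries.coeff_succ_X_mul, PowerSeries.coeff_succ_X_mul]
      simp only [hilbertSeriesSub, PowerSeries.coeff_mk, ← hrank]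
      simp [hF, Finset.sum_range_succ]
  have hser' : PowerSeries.mk (fun n ↦ (F n : ℚ)) =
      ((Polynomial.X * q : Polynomial ℚ) : PowerSeries ℚ) *
        PowerSeries.invOneSubPow ℚ (s + 1) := by
    rw [← Units.mul_inv_eq_iff_eq_mul, ← Units.inv_eq_val_inv,
      PowerSeries.invOneSubPow_inv_eq_one_sub_pow, mul_comm, pow_succ, mul_assoc, hser,
      mul_left_comm, Polynomial.coe_mul, ← hq, Polynomial.coe_X, Finset.card_univ, Fintype.card_fin]
  refine ⟨Polynomial.hilbertPoly (Polynomial.X * q) (s + 1), ?_⟩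
  filter_upwards [Filter.eventually_gt_atTop (Polynomial.X * q).natDegree] with n hn
  rw [← Polynomial.coeff_mul_invOneSubPow_eq_hilbertPoly_eval _ hn, ← hser', PowerSeries.coeff_mk]

end HilbertSeries

theorem ringKrullDim_eq_of_isIntegral (R S : Type*) [CommRing R] [CommRing S] [Algebra R S]
    [FaithfulSMul R S] [Algebra.IsIntegral R S] : ringKrullDim S = ringKrullDim R := by
  apply le_antisymm
  · exact Order.krullDim_le_of_strictMono (PrimeSpectrum.comap (algebraMap R S))
      fun p q h ↦ Ideal.IsIntegral.comap_lt_comap h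
  · refine iSup_le fun l ↦ ?_
    obtain ⟨P, hP⟩ := Algebra.IsIntegral.comap_surjective R S l.head
    have : P.asIdeal.LiesOver l.head.asIdeal := ⟨by rw [← hP]; rfl⟩
    obtain ⟨L, hL, -⟩ := Ideal.exists_ltSeries_of_hasGoingUp l P.asIdeal
    rw [← hL]
    exact Order.LTSeries.length_le_krullDim L

section Growth

open MvPolynomial

variable {k : Type v} [Field k]

theorem finrank_restrictTotalDegree_le (g M : ℕ) :
    Module.finrank k (restrictTotalDegree (Fin g) k M) ≤ (M + 1) ^ g := by
  refine (Submodule.finrank_mono (restrictTotalDegree_le_restrictDegree (Fin g) k M)).trans ?_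
  rw [restrictDegree, Module.finrank_eq_nat_card_basis (basisRestrictSupport k _)]
  let ι (d : {f : Fin g →₀ ℕ | ∀ a, f a ≤ M}) : Fin g → Fin (M + 1) :=
    fun i ↦ ⟨d.1 i, Nat.lt_succ_iff.2 (d.2 i)⟩
  have hι : Function.Injective ι := by
    intro d e h
    ext i
    exact congrArg Fin.val (congrFun h i)
  refine (Nat.card_le_card_of_injective ι hι).trans ?_
  simp

variable {G : Type*} [CommRing G] [Algebra k G] {s g : ℕ}

theorem exists_pow_le_finrank_map_restrictTotalDegree {φ : MvPolynomial (Fin s) k →ₐ[k] G}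
    (hφ : Function.Surjective φ) {ψ : MvPolynomial (Fin g) k →ₐ[k] G}
    (hψ : Function.Injective ψ) :
    ∃ e, ∀ n, n ^ g ≤
      Module.finrank k ((restrictTotalDegree (Fin s) k (e * n)).map φ.toLinearMap) := by
  choose P hP using fun j ↦ hφ (ψ (X j))
  let e := Finset.univ.sup fun j ↦ (P j).totalDegree
  refine ⟨g * e, fun n ↦ ?_⟩
  let mon (b : Fin g → Fin n) : Fin g →₀ ℕ := Finsupp.equivFunOnFinite.symm fun i ↦ (b i : ℕ)
  have hmon : Function.Injective mon := by
    intro b c h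
    ext i
    simpa [mon] using DFunLike.congr_fun h i
  have hmem (b : Fin g → Fin n) : ψ (monomial (mon b) 1) ∈
      (restrictTotalDegree (Fin s) k (g * e * n)).map φ.toLinearMap := by
    refine ⟨∏ i, P i ^ (b i : ℕ), (mem_restrictTotalDegree _ _ _).2 ?_, ?_⟩
    · refine (totalDegree_finsetProd _ _).trans ?_
      calc ∑ i, (P i ^ (b i : ℕ)).totalDegree ≤ ∑ i : Fin g, e * n := by
            refine Finset.sum_le_sum fun i _ ↦ (totalDegree_pow _ _).trans ?_
            rw [mul_comm]
            exact Nat.mul_le_mul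
              (Finset.le_sup (f := fun j ↦ (P j).totalDegree) (Finset.mem_univ i)) (b i).2.le
        _ = g * e * n := by simp [mul_assoc]
    · rw [AlgHom.toLinearMap_apply, map_prod, monomial_eq, map_mul, C_1, map_one, one_mul,
        Finsupp.prod_fintype _ _ (by simp), map_prod]
      simp [hP, mon]
  have hli : LinearIndependent k fun b : Fin g → Fin n ↦
      (⟨_, hmem b⟩ : (restrictTotalDegree (Fin s) k (g * e * n)).map φ.toLinearMap) := by
    refine LinearIndependent.of_comp (Submodule.subtype _) ?_
    refine LinearIndependent.map' (f := ψ.toLinearMap) (v := fun b ↦ monomial (mon b) 1) ?_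
      (LinearMap.ker_eq_bot.2 hψ)
    exact (basisMonomials (Fin g) k).linearIndependent.comp mon hmon
  simpa using hli.fintype_card_le_finrank

theorem exists_finrank_map_restrictTotalDegree_le (φ : MvPolynomial (Fin s) k →ₐ[k] G)
    {ψ : MvPolynomial (Fin g) k →ₐ[k] G} (hψ : ψ.Finite) :
    ∃ C, ∀ N, Module.finrank k ((restrictTotalDegree (Fin s) k N).map φ.toLinearMap) ≤
      C * (N + 1) ^ g := by
  algebraize [ψ.toRingHom]
  have hfin : Module.Finite (MvPolynomial (Fin g) k) G := hψ
  obtain ⟨r, w, hw⟩ := Module.Finite.exists_fin (R := MvPolynomial (Fin g) k) (M := G)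
  have hexp (x : G) : ∃ c : Fin r → MvPolynomial (Fin g) k, ∑ l, ψ (c l) * w l = x := by
    have hx : x ∈ Submodule.span (MvPolynomial (Fin g) k) (Set.range w) := by
      rw [hw]
      trivial
    exact (Submodule.mem_span_range_iff_exists_fun _).1 hx
  choose c hc using hexp
  let E₁ := Finset.univ.sup fun l ↦ (c 1 l).totalDegree
  let E₂ := Finset.univ.sup fun z : Fin s × Fin r × Fin r ↦
    (c (φ (X z.1) * w z.2.1) z.2.2).totalDegree
  let E := E₁ + E₂
  let Θ (M : ℕ) : (Fin r → restrictTotalDegree (Fin g) k M) →ₗ[k] G :=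
    ∑ l, LinearMap.mulRight k (w l) ∘ₗ ψ.toLinearMap ∘ₗ Submodule.subtype _ ∘ₗ LinearMap.proj l
  have hΘ (M : ℕ) (v) : Θ M v = ∑ l, ψ (v l) * w l := by simp [Θ]
  have hU {M : ℕ} {x : G} : x ∈ LinearMap.range (Θ M) ↔ ∃ a : Fin r → MvPolynomial (Fin g) k,
      (∀ l, (a l).totalDegree ≤ M) ∧ ∑ l, ψ (a l) * w l = x := by
    constructor
    · rintro ⟨v, rfl⟩
      exact ⟨fun l ↦ v l, fun l ↦ (mem_restrictTotalDegree _ _ _).1 (v l).2, (hΘ M v).symm⟩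
    · rintro ⟨a, ha, rfl⟩
      exact ⟨fun l ↦ ⟨a l, (mem_restrictTotalDegree _ _ _).2 (ha l)⟩, hΘ M _⟩
  have hstep {M : ℕ} {x : G} (i : Fin s) (hx : x ∈ LinearMap.range (Θ M)) :
      φ (X i) * x ∈ LinearMap.range (Θ (M + E)) := by
    obtain ⟨a, ha, rfl⟩ := hU.1 hx
    refine hU.2 ⟨fun l ↦ ∑ j, a j * c (φ (X i) * w j) l, fun l ↦ ?_, ?_⟩
    · refine totalDegree_finsetSum_le fun j _ ↦ (totalDegree_mul _ _).trans
        (Nat.add_le_add (ha j) ?_)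
      exact (Finset.le_sup (f := fun z : Fin s × Fin r × Fin r ↦
        (c (φ (X z.1) * w z.2.1) z.2.2).totalDegree) (Finset.mem_univ (i, j, l))).trans
        (Nat.le_add_left _ _)
    · simp_rw [map_sum, Finset.sum_mul]
      rw [Finset.sum_comm, Finset.mul_sum]
      refine Finset.sum_congr rfl fun j _ ↦ ?_
      rw [mul_left_comm, ← hc (φ (X i) * w j), Finset.mul_sum]
      refine Finset.sum_congr rfl fun l _ ↦ ?_
      rw [hc, map_mul, mul_assoc]
  have hmono {M M' : ℕ} (h : M ≤ M') : LinearMap.range (Θ M) ≤ LinearMap.range (Θ M') := by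
    intro x hx
    obtain ⟨a, ha, rfl⟩ := hU.1 hx
    exact hU.2 ⟨a, fun l ↦ (ha l).trans h, rfl⟩
  have hmonomial (N : ℕ) (d : Fin s →₀ ℕ) (hd : d.degree = N) (a : k) :
      φ (monomial d a) ∈ LinearMap.range (Θ (E * (N + 1))) := by
    induction N generalizing d with
    | zero =>
      rw [Finsupp.degree_eq_zero_iff] at hd
      rw [hd, show monomial 0 a = C a from rfl, C_eq_smul_one, map_smul, map_one]
      refine Submodule.smul_mem _ _ (hU.2 ⟨c 1, fun l ↦ ?_, hc 1⟩)
      exact (Finset.le_sup (f := fun l ↦ (c 1 l).totalDegree) (Finset.mem_univ l)).trans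
        (by rw [zero_add, mul_one]; exact Nat.le_add_right _ _)
    | succ N ih =>
      obtain ⟨i, hi⟩ : d.support.Nonempty := by
        rw [Finset.nonempty_iff_ne_empty, Ne, Finsupp.support_eq_empty]
        rintro rfl
        simp at hd
      have h := tsub_add_cancel_of_le (Finsupp.single_le_iff.2
        (Nat.one_le_iff_ne_zero.2 (Finsupp.mem_support_iff.1 hi)) : Finsupp.single i 1 ≤ d)
      have hd' : (d - Finsupp.single i 1).degree = N := by
        rw [← h, map_add, Finsupp.degree_single] at hd
        omega
      have h2 := hstep i (ih _ hd')
      rw [← map_mul, X, monomial_mul, one_mul, add_comm (Finsupp.single i 1), h] at h2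
      exact hmono (by ring_nf; rfl) h2
  refine ⟨r * (E + 1) ^ g, fun N ↦ ?_⟩
  have hle : (restrictTotalDegree (Fin s) k N).map φ.toLinearMap ≤
      LinearMap.range (Θ (E * (N + 1))) := by
    rintro _ ⟨p, hp, rfl⟩
    have hp' := (mem_restrictTotalDegree _ _ _).1 hp
    rw [AlgHom.toLinearMap_apply, p.as_sum, map_sum]
    refine sum_mem fun d hd ↦ hmono ?_ (hmonomial _ d rfl _)
    gcongr
    exact (le_totalDegree hd).trans hp'
  calc _ ≤ Module.finrank k (LinearMap.range (Θ (E * (N + 1)))) := Submodule.finrank_mono hle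
    _ ≤ Module.finrank k (Fin r → restrictTotalDegree (Fin g) k (E * (N + 1))) :=
      LinearMap.finrank_range_le _
    _ = r * Module.finrank k (restrictTotalDegree (Fin g) k (E * (N + 1))) := by
      rw [Module.finrank_pi_fintype]
      simp
    _ ≤ r * (E * (N + 1) + 1) ^ g := Nat.mul_le_mul_left _ (finrank_restrictTotalDegree_le _ _)
    _ ≤ r * ((E + 1) * (N + 1)) ^ g := by
      gcongr
      nlinarith
    _ = r * (E + 1) ^ g * (N + 1) ^ g := by rw [mul_pow, mul_assoc]

/-- The Krull dimension of a finitely generated algebra is its rate of growth. -/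
theorem exists_ringKrullDim_eq_and_growth [Nontrivial G] {φ : MvPolynomial (Fin s) k →ₐ[k] G}
    (hφ : Function.Surjective φ) :
    ∃ g : ℕ, ringKrullDim G = g ∧
      (∃ e, ∀ n, n ^ g ≤
        Module.finrank k ((restrictTotalDegree (Fin s) k (e * n)).map φ.toLinearMap)) ∧
      ∃ C, ∀ N, Module.finrank k ((restrictTotalDegree (Fin s) k N).map φ.toLinearMap) ≤
        C * (N + 1) ^ g := by
  have hft : Algebra.FiniteType k G := Algebra.FiniteType.of_surjective φ hφ
  obtain ⟨g, ψ, hinj, hfin⟩ := exists_finite_inj_algHom_of_fg k G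
  refine ⟨g, ?_, exists_pow_le_finrank_map_restrictTotalDegree hφ hinj,
    exists_finrank_map_restrictTotalDegree_le φ hfin⟩
  algebraize [ψ.toRingHom]
  have : Module.Finite (MvPolynomial (Fin g) k) G := hfin
  have : FaithfulSMul (MvPolynomial (Fin g) k) G := (faithfulSMul_iff_algebraMap_injective _ _).2 hinj
  rw [ringKrullDim_eq_of_isIntegral (MvPolynomial (Fin g) k) G,
    MvPolynomial.ringKrullDim_of_isNoetherianRing]
  simp

end Growth

section LocalRing

open IsLocalRing Filter

theorem exists_fin_span_range_eq {R : Type u} [CommRing R] {I : Ideal R} (hI : I.FG) :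
    ∃ (s : ℕ) (t : Fin s → I), Ideal.span (Set.range fun i ↦ (t i : R)) = I := by
  obtain ⟨s, t, ht⟩ := Submodule.fg_iff_exists_fin_generating_family.1 hI
  have hmem (i : Fin s) : t i ∈ I := ht ▸ Submodule.subset_span ⟨i, rfl⟩
  exact ⟨s, fun i ↦ ⟨t i, hmem i⟩, ht⟩

variable {R : Type u} [CommRing R] [IsLocalRing R]

theorem nontrivial_assocGraded_maximalIdeal : Nontrivial (AssocGraded (maximalIdeal R)) := by
  refine ⟨⟨1, 0, fun h ↦ ?_⟩⟩
  have h' : (1 : reesAlgebra (maximalIdeal R)) ∈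
      Ideal.map (algebraMap R (reesAlgebra (maximalIdeal R))) (maximalIdeal R) :=
    Ideal.Quotient.eq_zero_iff_mem.1 h
  have h0 : (1 : R) ∈ maximalIdeal R ^ (0 + 1) := by
    have := mem_map_reesAlgebra_iff.1 h' 0
    rwa [OneMemClass.coe_one, Polynomial.coeff_one_zero] at this
  rw [zero_add, pow_one] at h0
  exact (Ideal.ne_top_iff_one _).1 (maximalIdeal.isMaximal R).ne_top h0

theorem exists_hilbertSamuel_of_surjective (k : Type*) [Field k] [Algebra R k]
    [Algebra k (AssocGraded (maximalIdeal R))]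
    [IsScalarTower R k (AssocGraded (maximalIdeal R))]
    (hk : Function.Surjective (algebraMap R k)) (hfg : (maximalIdeal R).FG) :
    IsNoetherianRing (AssocGraded (maximalIdeal R)) ∧
    ∃ f : ℕ → ℕ, (∀ n, Module.length R (R ⧸ maximalIdeal R ^ n) = f n) ∧
      (∃ HS : Polynomial ℚ, ∀ᶠ n : ℕ in atTop, HS.eval (n : ℚ) = f n) ∧
      ∃ g : ℕ, ringKrullDim (AssocGraded (maximalIdeal R)) = g ∧
        (∃ e, ∀ n, n ^ g ≤ f (e * n + 1)) ∧ ∃ C, ∀ n, f (n + 1) ≤ C * (n + 1) ^ g := by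
  obtain ⟨s, t, ht⟩ := exists_fin_span_range_eq hfg
  have := nontrivial_assocGraded_maximalIdeal (R := R)
  have hsurj := AssocGraded.presentation_surjective (k := k) t ht
  refine ⟨isNoetherianRing_of_surjective _ _ (AssocGraded.presentation k t).toRingHom hsurj, _,
    AssocGraded.length_quotient_pow (k := k) t hk ht, ?_, ?_⟩
  · exact exists_polynomial_eval_eq_sum_finrank (AssocGraded.presentation k t).toLinearMap
      (RingHom.ker (AssocGraded.presentation k t)) rfl
      fun p hp n ↦ AssocGraded.homogeneousComponent_mem_ker t hk hp n
  · obtain ⟨g, hg, ⟨e, he⟩, C, hC⟩ := exists_ringKrullDim_eq_and_growth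
      (G := AssocGraded (maximalIdeal R)) hsurj
    refine ⟨g, hg, ⟨e, fun n ↦ (he n).trans_eq ?_⟩, C, fun n ↦ (hC n).trans_eq' ?_⟩
    · exact AssocGraded.finrank_map_restrictTotalDegree t hk _
    · exact AssocGraded.finrank_map_restrictTotalDegree t hk _

theorem exists_hilbertSamuel (hfg : (maximalIdeal R).FG) :
    IsNoetherianRing (AssocGraded (maximalIdeal R)) ∧
    ∃ f : ℕ → ℕ, (∀ n, Module.length R (R ⧸ maximalIdeal R ^ n) = f n) ∧
      (∃ HS : Polynomial ℚ, ∀ᶠ n : ℕ in atTop, HS.eval (n : ℚ) = f n) ∧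
      ∃ g : ℕ, ringKrullDim (AssocGraded (maximalIdeal R)) = g ∧
        (∃ e, ∀ n, n ^ g ≤ f (e * n + 1)) ∧ ∃ C, ∀ n, f (n + 1) ≤ C * (n + 1) ^ g := by
  let _ : Algebra (ResidueField R) (AssocGraded (maximalIdeal R)) :=
    Ideal.Quotient.algebraQuotientMapQuotient
  have : IsScalarTower R (ResidueField R) (AssocGraded (maximalIdeal R)) :=
    Ideal.Quotient.tower_quotient_map_quotient
  exact exists_hilbertSamuel_of_surjective (ResidueField R) residue_surjective hfg

end LocalRing

section Asymptotics

open Filter Polynomial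

variable {f : ℕ → ℕ} {HS : Polynomial ℚ}

theorem exists_le_mul_pow_natDegree
    (h : ∀ᶠ n : ℕ in atTop, HS.eval (n : ℚ) = f n) :
    ∃ C : ℕ, ∀ n, f n ≤ C * (n + 1) ^ HS.natDegree := by
  obtain ⟨N, hN⟩ := eventually_atTop.1 h
  obtain ⟨B, hB⟩ := exists_nat_ge (∑ i ∈ Finset.range (HS.natDegree + 1), |HS.coeff i|)
  refine ⟨B + ∑ i ∈ Finset.range N, f i, fun n ↦ ?_⟩
  rcases lt_or_ge n N with hn | hn
  · calc f n ≤ ∑ i ∈ Finset.range N, f i :=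
          Finset.single_le_sum (fun _ _ ↦ Nat.zero_le _) (Finset.mem_range.2 hn)
      _ ≤ (B + ∑ i ∈ Finset.range N, f i) * 1 := by omega
      _ ≤ _ := Nat.mul_le_mul_left _ (Nat.one_le_pow _ _ n.succ_pos)
  · refine le_trans ?_ (Nat.mul_le_mul_right _ (Nat.le_add_right B _))
    rw [← Nat.cast_le (α := ℚ), ← hN n hn, eval_eq_sum_range]
    push_cast
    refine le_trans ?_ (mul_le_mul_of_nonneg_right hB (by positivity))
    rw [Finset.sum_mul]
    refine Finset.sum_le_sum fun i hi ↦ ?_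
    refine mul_le_mul (le_abs_self _) ?_ (by positivity) (abs_nonneg _)
    refine (pow_le_pow_left₀ (by positivity) (by linarith : (n : ℚ) ≤ n + 1) i).trans ?_
    exact pow_le_pow_right₀ (by linarith [n.cast_nonneg (α := ℚ)])
      (Nat.lt_succ_iff.1 (Finset.mem_range.1 hi))

theorem natDegree_le_of_le_mul_pow (h : ∀ᶠ n : ℕ in atTop, HS.eval (n : ℚ) = f n)
    {C p : ℕ} (hC : ∀ n, f n ≤ C * (n + 1) ^ p) : HS.natDegree ≤ p := by
  by_contra! hp
  let Q : Polynomial ℚ := Polynomial.C ((C : ℚ) + 1) * (X + 1) ^ p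
  have hQ0 : Q ≠ 0 := mul_ne_zero (C_ne_zero.2 (by positivity))
    (pow_ne_zero _ (X_add_C_ne_zero (1 : ℚ)))
  have hQ : Q.degree < HS.degree := by
    refine degree_lt_degree (lt_of_le_of_lt ?_ hp)
    exact (natDegree_C_mul_le _ _).trans (natDegree_pow_le_of_le (m := 1) p (by compute_degree) |>.trans_eq (mul_one p))
  have hlim := (abs_div_tendsto_atTop_atTop_of_degree_gt HS Q hQ hQ0).comp
    (tendsto_natCast_atTop_atTop (R := ℚ))
  obtain ⟨n, hn, hn'⟩ := (h.and (hlim.eventually_gt_atTop 1)).exists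
  have hQn : 0 < Q.eval (n : ℚ) := by
    simp only [Q, eval_mul, eval_C, eval_pow, eval_add, eval_X, eval_one]
    positivity
  have hfn : (f n : ℚ) ≤ Q.eval (n : ℚ) := by
    simp only [Q, eval_mul, eval_C, eval_pow, eval_add, eval_X, eval_one]
    have : (f n : ℚ) ≤ C * (n + 1) ^ p := by exact_mod_cast hC n
    have h1 : (0 : ℚ) ≤ (n + 1) ^ p := by positivity
    linarith
  rw [Function.comp_apply, abs_of_nonneg (by rw [hn]; positivity), hn, lt_div_iff₀ hQn] at hn'
  linarith

theorem le_of_pow_le_mul_pow {g D C e : ℕ} (h : ∀ n, n ^ g ≤ C * (e * n + 2) ^ D) : g ≤ D := by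
  by_contra! hg
  have h1 (n : ℕ) (hn : 1 ≤ n) : n ≤ C * (e + 2) ^ D := by
    have h2 : n ^ (D + 1) ≤ C * ((e + 2) * n) ^ D :=
      (Nat.pow_le_pow_right hn hg).trans ((h n).trans
        (Nat.mul_le_mul_left _ (Nat.pow_le_pow_left (by nlinarith) _)))
    rw [mul_pow, ← mul_assoc, pow_succ'] at h2
    exact Nat.le_of_mul_le_mul_right h2 (by positivity)
  have := h1 (C * (e + 2) ^ D + 1) (by omega)
  omega

end Asymptotics

section Completion

open IsLocalRing

variable {R : Type u} {A : Type v} [CommRing R] [CommRing A] [Algebra R A]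

theorem length_quotient_eq_of_comap_eq {I : Ideal R} {J : Ideal A}
    (hI : J.comap (algebraMap R A) = I)
    (hJ : ∀ a, ∃ r, a - algebraMap R A r ∈ J) :
    Module.length A (A ⧸ J) = Module.length R (R ⧸ I) := by
  have hsurj : Function.Surjective (algebraMap R (A ⧸ J)) := by
    intro b
    obtain ⟨a, rfl⟩ := Ideal.Quotient.mk_surjective b
    obtain ⟨r, hr⟩ := hJ a
    exact ⟨r, ((Ideal.Quotient.mk_eq_mk_iff_sub_mem _ _).2 hr).symm⟩
  have hker : LinearMap.ker (Algebra.linearMap R (A ⧸ J)) = I := by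
    ext r
    rw [← hI, LinearMap.mem_ker, Ideal.mem_comap, ← Ideal.Quotient.eq_zero_iff_mem]
    rfl
  have e := (Submodule.quotEquivOfEq _ _ hker).symm.trans
    ((Algebra.linearMap R (A ⧸ J)).quotKerEquivOfSurjective hsurj)
  rw [e.length_eq, Module.length_eq_of_surjective (S := R) (R := A ⧸ J) hsurj,
    Module.length_eq_of_surjective (S := A) (R := A ⧸ J) Ideal.Quotient.mk_surjective]

variable [IsLocalRing R] [IsLocalRing A]

theorem isArtinianRing_quotient_of_pow_le (hfin : ∀ n, Module.length R (R ⧸ maximalIdeal R ^ n) ≠ ⊤)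
    {I : Ideal R} {n : ℕ} (h : maximalIdeal R ^ n ≤ I) : IsArtinianRing (R ⧸ I) := by
  have := (isFiniteLength_iff_isNoetherian_isArtinian.1 (Module.length_ne_top_iff.1 (hfin n))).2
  have : IsArtinian R (R ⧸ I) := isArtinian_of_surjective _ (Submodule.factor h)
    (Submodule.factor_surjective h)
  exact isArtinian_of_tower R this

theorem exists_isArtinianRing_quotient_of_ringKrullDim [IsNoetherianRing A]
    (hfg : (maximalIdeal R).FG) (hfin : ∀ n, Module.length R (R ⧸ maximalIdeal R ^ n) ≠ ⊤)
    (hcomap : ∀ n, (maximalIdeal A ^ n).comap (algebraMap R A) = maximalIdeal R ^ n)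
    (hdense : ∀ n a, ∃ r, a - algebraMap R A r ∈ maximalIdeal A ^ n) :
    ∃ c : ℕ, ringKrullDim A = c ∧ ∃ x : Fin c → R, (∀ i, x i ∈ maximalIdeal R) ∧
      IsArtinianRing (R ⧸ Ideal.span (Set.range x)) := by
  obtain ⟨S, hS, hcard⟩ := Ideal.exists_finset_card_eq_height_of_isNoetherianRing (maximalIdeal A)
  have hdim : ringKrullDim A = S.card := by
    rw [← maximalIdeal_height_eq_ringKrullDim, ← hcard]
    rfl
  refine ⟨S.card, hdim, ?_⟩
  let y : Fin S.card → A := fun i ↦ S.equivFin.symm i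
  have hy : Set.range y = S := by
    ext a
    constructor
    · rintro ⟨i, rfl⟩
      exact (S.equivFin.symm i).2
    · exact fun ha ↦ ⟨S.equivFin ⟨a, ha⟩, by simp [y]⟩
  rw [← hy] at hS
  have hym (i) : y i ∈ maximalIdeal A := hS.1.2 (Ideal.subset_span ⟨i, rfl⟩)
  obtain ⟨r, hr⟩ := Ideal.exists_pow_le_of_le_radical_of_fg (I := maximalIdeal A)
    (J := Ideal.span (Set.range y)) (by
      rw [Ideal.radical_eq_sInf]
      refine le_sInf fun P hP ↦ ?_
      have := hP.2
      exact hS.2 ⟨hP.2, hP.1⟩ (le_maximalIdeal this.ne_top)) (IsNoetherian.noetherian _)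
  choose x hx using fun i ↦ hdense (r + 1) (y i)
  have hxm (i) : x i ∈ maximalIdeal R := by
    rw [← pow_one (maximalIdeal R), ← hcomap, Ideal.mem_comap, pow_one]
    rw [← sub_sub_cancel (y i) (algebraMap R A (x i))]
    exact sub_mem (hym i) (Ideal.pow_le_self r.succ_ne_zero (hx i))
  refine ⟨x, hxm, isArtinianRing_quotient_of_pow_le hfin (n := r) ?_⟩
  refine Submodule.le_of_le_smul_of_le_jacobson_bot (I := maximalIdeal R) (Ideal.FG.pow hfg)
    (maximalIdeal_le_jacobson _) fun z hz ↦ ?_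
  have hz' : algebraMap R A z ∈ maximalIdeal A ^ r := by
    rwa [← hcomap, Ideal.mem_comap] at hz
  obtain ⟨a, ha⟩ := (Submodule.mem_span_range_iff_exists_fun A).1 (hr hz')
  choose b hb using fun i ↦ hdense (r + 1) (a i)
  have hsub : z - ∑ i, b i * x i ∈ maximalIdeal R ^ (r + 1) := by
    rw [← hcomap, Ideal.mem_comap, map_sub, ← ha, map_sum, ← Finset.sum_sub_distrib]
    refine sum_mem fun i _ ↦ ?_
    rw [map_mul, smul_eq_mul, show a i * y i - algebraMap R A (b i) * algebraMap R A (x i) =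
      (a i - algebraMap R A (b i)) * y i +
        algebraMap R A (b i) * (y i - algebraMap R A (x i)) by ring]
    exact add_mem (Ideal.mul_mem_right _ _ (hb i)) (Ideal.mul_mem_left _ _ (hx i))
  rw [← add_sub_cancel (∑ i, b i * x i) z]
  refine Submodule.add_mem_sup (sum_mem fun i _ ↦ Ideal.mul_mem_left _ _
    (Ideal.subset_span ⟨i, rfl⟩)) ?_
  rwa [smul_eq_mul, ← pow_succ']

end Completion

section AdicCompletion

open IsLocalRing

variable {R : Type u} [CommRing R] {I : Ideal R}

theorem AdicCompletion.mem_map_pow_iff_evalₐ_eq_zero (hI : I.FG) (n : ℕ) (a : AdicCompletion I R) :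
    a ∈ I.map (algebraMap R (AdicCompletion I R)) ^ n ↔ evalₐ I n a = 0 := by
  have h := pow_smul_top_eq_ker_eval (M := R) (n := n) hI
  rw [← Ideal.map_pow, ← Submodule.restrictScalars_mem R, ← Ideal.smul_top_eq_map, h,
    LinearMap.mem_ker]
  constructor <;> intro ha
  · rw [← factor_eval_eq_evalₐ I a (by simp), ha]
    exact _root_.map_zero _
  · rw [← factor_evalₐ_eq_eval I a (by simp), ha, _root_.map_zero]

theorem AdicCompletion.comap_map_pow (hI : I.FG) (n : ℕ) :
    (I.map (algebraMap R (AdicCompletion I R)) ^ n).comap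
      (algebraMap R (AdicCompletion I R)) = I ^ n := by
  ext r
  rw [Ideal.mem_comap, mem_map_pow_iff_evalₐ_eq_zero hI, AlgHom.commutes]
  exact Ideal.Quotient.eq_zero_iff_mem

theorem AdicCompletion.exists_sub_algebraMap_mem (hI : I.FG) (n : ℕ) (a : AdicCompletion I R) :
    ∃ r, a - algebraMap R _ r ∈ I.map (algebraMap R (AdicCompletion I R)) ^ n := by
  obtain ⟨r, hr⟩ := Ideal.Quotient.mk_surjective (evalₐ I n a)
  refine ⟨r, ?_⟩
  rw [mem_map_pow_iff_evalₐ_eq_zero hI, map_sub, AlgHom.commutes, ← hr]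
  exact sub_self _

end AdicCompletion

section DimensionTheory

open IsLocalRing Filter

variable {R : Type u} [CommRing R] [IsLocalRing R]

theorem exists_length_quotient_pow_le_of_isArtinianRing {n : ℕ} {x : Fin n → R}
    (hx : ∀ i, x i ∈ maximalIdeal R) [IsArtinianRing (R ⧸ Ideal.span (Set.range x))] :
    ∃ C : ℕ, ∀ N, Module.length R (R ⧸ maximalIdeal R ^ N) ≤ (C * (N + 1) ^ n : ℕ) := by
  have h : Module.length R (R ⧸ Ideal.span (Set.range x)) ≠ ⊤ := by
    rw [Module.length_eq_of_surjective (S := R) (R := R ⧸ Ideal.span (Set.range x))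
      Ideal.Quotient.mk_surjective, Module.length_ne_top_iff,
      isFiniteLength_iff_isNoetherian_isArtinian]
    exact ⟨inferInstance, inferInstance⟩
  obtain ⟨C, hC⟩ := ENat.ne_top_iff_exists.1 h
  refine ⟨C, fun N ↦ (length_quotient_pow_le x hx N).trans ?_⟩
  rw [← hC, mul_comm]
  exact_mod_cast Nat.mul_le_mul_left C (Nat.pow_le_pow_left N.le_succ n)

/-- The completion of a local ring of finite embedding dimension is Noetherian. -/
theorem isNoetherianRing_adicCompletion (hfg : (maximalIdeal R).FG) :
    IsNoetherianRing (AdicCompletion (maximalIdeal R) R) := by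
  have := AdicCompletion.isLocalRing_of_fg hfg
  have := AdicCompletion.isAdicComplete_of_fg hfg
  have hfg' : (maximalIdeal (AdicCompletion (maximalIdeal R) R)).FG :=
    AdicCompletion.maximalIdeal_eq_map_of_fg hfg ▸ hfg.map _
  have := (exists_hilbertSamuel hfg').1
  exact isNoetherianRing_of_isAdicComplete
    (I := maximalIdeal (AdicCompletion (maximalIdeal R) R))

end DimensionTheory

theorem pdim_eq_completion_dim_eq_graded_dim_eq_hilbert_samuel_degree
    (R : Type u) [CommRing R] [IsLocalRing R]
    (hfg : (IsLocalRing.maximalIdeal R).FG) :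
    ∃ d : ℕ,
      sInf {n : ℕ | ∃ x : Fin n → R, (∀ i, x i ∈ IsLocalRing.maximalIdeal R) ∧
          IsArtinianRing (R ⧸ Ideal.span (Set.range x))} = d ∧
      ringKrullDim (AdicCompletion (IsLocalRing.maximalIdeal R) R) = (d : WithBot ℕ∞) ∧
      ringKrullDim (AssocGradedOfLocal R) = (d : WithBot ℕ∞) ∧
      ∃ len : ℕ → ℕ,
        (∀ n : ℕ, modLength R (R ⧸ (IsLocalRing.maximalIdeal R ^ n : Ideal R))
            = (len n : WithBot ℕ∞)) ∧
        ∃ HS : Polynomial ℚ,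
          (∀ᶠ n : ℕ in Filter.atTop, HS.eval (n : ℚ) = (len n : ℚ)) ∧
          HS.natDegree = d := by
  obtain ⟨-, f, hf, ⟨HS, hHS⟩, g, hg, ⟨e, he⟩, B, hB⟩ := exists_hilbertSamuel hfg
  have hfin (n : ℕ) : Module.length R (R ⧸ IsLocalRing.maximalIdeal R ^ n) ≠ ⊤ := by
    simp [hf n]
  obtain ⟨C, hC⟩ := exists_le_mul_pow_natDegree hHS
  have hgD : g = HS.natDegree := by
    refine le_antisymm (le_of_pow_le_mul_pow fun n ↦ (he n).trans (hC _)) ?_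
    refine natDegree_le_of_le_mul_pow hHS (C := f 0 + B) fun n ↦ ?_
    cases n with
    | zero => simp
    | succ n =>
      exact (hB n).trans (Nat.mul_le_mul (Nat.le_add_left _ _)
        (Nat.pow_le_pow_left (Nat.le_succ _) _))
  have := AdicCompletion.isLocalRing_of_fg hfg
  have := isNoetherianRing_adicCompletion hfg
  have hm := AdicCompletion.maximalIdeal_eq_map_of_fg hfg
  have hcomap := AdicCompletion.comap_map_pow hfg
  have hdense := AdicCompletion.exists_sub_algebraMap_mem hfg
  rw [← hm] at hcomap hdense
  obtain ⟨c, hc, x, hxm, hx⟩ :=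
    exists_isArtinianRing_quotient_of_ringKrullDim hfg hfin hcomap hdense
  have hlower {n : ℕ} {x : Fin n → R} (hxm : ∀ i, x i ∈ IsLocalRing.maximalIdeal R)
      (hx : IsArtinianRing (R ⧸ Ideal.span (Set.range x))) : HS.natDegree ≤ n := by
    obtain ⟨C, hC⟩ := exists_length_quotient_pow_le_of_isArtinianRing hxm
    refine natDegree_le_of_le_mul_pow hHS (C := C) fun N ↦ ?_
    have := hC N
    rw [hf] at this
    exact_mod_cast this
  have hcD : c ≤ HS.natDegree := by
    have := ringKrullDim_le_of_length_quotient_le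
      (A := AdicCompletion (IsLocalRing.maximalIdeal R) R) HS.natDegree C fun n ↦ by
        rw [length_quotient_eq_of_comap_eq (hcomap n) (hdense n), hf]
        exact_mod_cast hC n
    rw [hc] at this
    exact_mod_cast this
  obtain rfl : c = HS.natDegree := le_antisymm hcD (hlower hxm hx)
  refine ⟨HS.natDegree, ?_, hc, hgD ▸ hg, f, fun n ↦ ?_, HS, hHS, rfl⟩
  · exact le_antisymm (Nat.sInf_le ⟨x, hxm, hx⟩)
      (le_csInf ⟨_, x, hxm, hx⟩ fun n ⟨x, hxm, hx⟩ ↦ hlower hxm hx)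
  · rw [modLength, ← Module.coe_length, hf]
    rfl
end

section
/- Let u be a nonprincipal ultrafilter on ℕ, and for each w ∈ ℕ let (R_w, m_w) be a local ring whose maximal ideal m_w is generated by at most e elements, for a fixed e. Let R♮ = (∏_w R_w)/{f : f(w) = 0 for u-almost all w} be the ultraproduct of the R_w; it is a local ring whose maximal ideal m♮ consists of the classes of those f with f(w) ∈ m_w for u-almost all w. Then the cataproduct R♯ := R♮/⋂_n (m♮)^n is a Noetherian local ring, and the natural map from R♯ to the m♮-adic completion of R♮ is an isomorphism; in particular R♯ is a complete Noetherian local ring. -/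
/-!
STATEMENT 11: Let `u` be a nonprincipal ultrafilter on `ℕ` and `(R_w, m_w)` local rings
whose maximal ideals are generated by at most `e` elements.  The ultraproduct
`R♮ = (∏ R_w)/{f | f(w) = 0 a.e.}` is a local ring whose maximal ideal is the
ultraproduct of the `m_w`, and the cataproduct `R♯ = R♮/⋂ₙ (m♮)ⁿ` is a Noetherian local
ring naturally isomorphic to the `m♮`-adic completion of `R♮` (in particular `R♯` is a
complete Noetherian local ring).
-/

universe u

open Filter

/-- The ideal of a product of rings consisting of the elements vanishing `u`-almost
everywhere. -/
def ultraIdeal (u : Ultrafilter ℕ) (R : ℕ → Type u) [∀ w, CommRing (R w)] :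
    Ideal (∀ w, R w) where
  carrier := {f | ∀ᶠ w in (u : Filter ℕ), f w = 0}
  zero_mem' := Eventually.of_forall fun _ => rfl
  add_mem' := by
    intro a b ha hb
    filter_upwards [ha, hb] with w h1 h2
    simp [h1, h2]
  smul_mem' := by
    intro c f hf
    filter_upwards [hf] with w h
    simp [h]

/-- The ultraproduct of a family of rings. -/
abbrev Ultraproduct (u : Ultrafilter ℕ) (R : ℕ → Type u) [∀ w, CommRing (R w)] :=
  (∀ w, R w) ⧸ ultraIdeal u R

/-- The ideal of a product of local rings consisting of the elements lying in the
maximal ideal `u`-almost everywhere. -/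
def ultraMaxPre (u : Ultrafilter ℕ) (R : ℕ → Type u) [∀ w, CommRing (R w)]
    [∀ w, IsLocalRing (R w)] : Ideal (∀ w, R w) where
  carrier := {f | ∀ᶠ w in (u : Filter ℕ), f w ∈ IsLocalRing.maximalIdeal (R w)}
  zero_mem' := Eventually.of_forall fun w => zero_mem _
  add_mem' := by
    intro a b ha hb
    filter_upwards [ha, hb] with w h1 h2
    exact add_mem h1 h2
  smul_mem' := by
    intro c f hf
    filter_upwards [hf] with w h
    exact Ideal.mul_mem_left _ _ h

theorem Ideal.FG.of_isNoetherianRing_quotient {A : Type*} [CommRing A] {J K : Ideal A}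
    (hJ : J.FG) (hJK : J ≤ K) [IsNoetherianRing (A ⧸ J)] : K.FG :=
  Ideal.fg_of_fg_map_of_fg_inf_ker_of_surjective (f := Ideal.Quotient.mk J)
    (IsNoetherian.noetherian _) (by rwa [Ideal.mk_ker, inf_eq_right.mpr hJK])
    Ideal.Quotient.mk_surjective

theorem Ideal.exists_fg_le_sup_of_isNoetherianRing_quotient {A : Type*} [CommRing A]
    (J P : Ideal A) [IsNoetherianRing (A ⧸ J)] : ∃ K : Ideal A, K.FG ∧ K ≤ P ∧ P ≤ K ⊔ J := by
  classical
  obtain ⟨s, hs⟩ := (IsNoetherian.noetherian (P.map (Ideal.Quotient.mk J)) : Submodule.FG _)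
  have hsP : (s : Set (A ⧸ J)) ⊆ Ideal.Quotient.mk J '' P := fun y hy ↦
    (Ideal.mem_map_iff_of_surjective _ Ideal.Quotient.mk_surjective).mp
      (hs ▸ Submodule.subset_span hy)
  obtain ⟨t, htP, rfl⟩ := Finset.subset_set_image_iff.mp hsP
  refine ⟨Ideal.span t, ⟨t, rfl⟩, Ideal.span_le.mpr htP, ?_⟩
  have hmap : P.map (Ideal.Quotient.mk J) = (Ideal.span (t : Set A)).map (Ideal.Quotient.mk J) := by
    rw [Ideal.map_span, ← Finset.coe_image]
    exact hs.symm
  calc P ≤ (P.map (Ideal.Quotient.mk J)).comap (Ideal.Quotient.mk J) := Ideal.le_comap_map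
    _ = Ideal.span t ⊔ J := by
      rw [hmap, Ideal.comap_map_of_surjective _ Ideal.Quotient.mk_surjective,
        ← RingHom.ker_eq_comap_bot, Ideal.mk_ker]

/-- If every finitely generated ideal is closed in the `m`-adic topology, then a prime ideal
avoiding `x ∈ m` is finitely generated as soon as its image modulo `x` is. -/
theorem Ideal.IsPrime.fg_of_closed {A : Type*} [CommRing A] {m J P : Ideal A} (hP : P.IsPrime)
    (hclosed : ∀ L : Ideal A, L.FG → ⨅ k : ℕ, L ⊔ m ^ k ≤ L) {x : A} (hxm : x ∈ m) (hxP : x ∉ P)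
    (hJ : J.FG) (hJP : J ≤ P) [IsNoetherianRing (A ⧸ (J ⊔ Ideal.span {x}))] : P.FG := by
  obtain ⟨K, hK, hKP, hPK⟩ :=
    Ideal.exists_fg_le_sup_of_isNoetherianRing_quotient (J ⊔ Ideal.span {x}) P
  have hLP : K ⊔ J ≤ P := sup_le hKP hJP
  have step : ∀ p ∈ P, ∃ q ∈ P, p - x * q ∈ K ⊔ J := by
    intro p hp
    obtain ⟨l, hl, y, hy, rfl⟩ := Submodule.mem_sup.mp (sup_assoc K J _ ▸ hPK hp)
    obtain ⟨q, rfl⟩ := Ideal.mem_span_singleton'.mp hy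
    refine ⟨q, ?_, by rwa [mul_comm x, add_sub_cancel_right]⟩
    have : q * x ∈ P := by simpa using sub_mem hp (hLP hl)
    exact (hP.mem_or_mem this).resolve_right hxP
  have pow_step : ∀ k : ℕ, ∀ p ∈ P, ∃ q ∈ P, p - x ^ k * q ∈ K ⊔ J := by
    intro k
    induction k with
    | zero => exact fun p hp ↦ ⟨p, hp, by simp⟩
    | succ k ih =>
      intro p hp
      obtain ⟨q, hq, hpq⟩ := ih p hp
      obtain ⟨r, hr, hqr⟩ := step q hq
      refine ⟨r, hr, ?_⟩
      convert add_mem hpq (Ideal.mul_mem_left _ (x ^ k) hqr) using 1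
      ring
  have hP_le : P ≤ K ⊔ J := fun p hp ↦ hclosed _ (Submodule.FG.sup hK hJ) <| by
    refine (Submodule.mem_iInf _).mpr fun k ↦ ?_
    obtain ⟨q, -, hq⟩ := pow_step k p hp
    exact Submodule.mem_sup.mpr
      ⟨_, hq, _, Ideal.mul_mem_right q _ (Ideal.pow_mem_pow hxm k), by ring⟩
  exact le_antisymm hLP hP_le ▸ Submodule.FG.sup hK hJ

theorem isNoetherianRing_quotient_of_closed {A : Type*} [CommRing A] {m : Ideal A}
    [IsNoetherianRing (A ⧸ m)] (hclosed : ∀ L : Ideal A, L.FG → ⨅ k : ℕ, L ⊔ m ^ k ≤ L)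
    (t : Finset A) : ∀ J : Ideal A, J.FG → J ⊔ Ideal.span t = m → IsNoetherianRing (A ⧸ J) := by
  classical
  induction t using Finset.induction_on with
  | empty =>
    intro J _ hJm
    obtain rfl : J = m := by simpa using hJm
    infer_instance
  | insert x t _ ih =>
    intro J hJ hJm
    rw [Finset.coe_insert, Ideal.span_insert, ← sup_assoc] at hJm
    have hJx : (J ⊔ Ideal.span {x}).FG := Submodule.FG.sup hJ ⟨{x}, by simp⟩
    have := ih _ hJx hJm
    refine .of_prime fun Q hQ ↦ ?_
    have hP := hQ.comap (Ideal.Quotient.mk J)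
    have hJP : J ≤ Q.comap (Ideal.Quotient.mk J) := by
      simpa using Ideal.ker_le_comap (K := Q) (Ideal.Quotient.mk J)
    rw [← Ideal.map_comap_of_surjective _ Ideal.Quotient.mk_surjective Q]
    refine Ideal.FG.map ?_ _
    by_cases hx : x ∈ Q.comap (Ideal.Quotient.mk J)
    · exact hJx.of_isNoetherianRing_quotient
        (sup_le hJP ((Ideal.span_singleton_le_iff_mem _).mpr hx))
    · exact hP.fg_of_closed hclosed
        (hJm ▸ Ideal.mem_sup_left (Ideal.mem_sup_right (Ideal.mem_span_singleton_self x))) hx hJ hJP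

/-- A ring is Noetherian if it has a finitely generated ideal `m` with Noetherian quotient such
that every finitely generated ideal is closed in the `m`-adic topology. -/
theorem isNoetherianRing_of_closed {A : Type*} [CommRing A] {m : Ideal A} (hm : m.FG)
    [IsNoetherianRing (A ⧸ m)] (hclosed : ∀ L : Ideal A, L.FG → ⨅ k : ℕ, L ⊔ m ^ k ≤ L) :
    IsNoetherianRing A := by
  obtain ⟨t, ht⟩ := hm
  have := isNoetherianRing_quotient_of_closed hclosed t ⊥ Submodule.fg_bot (by simpa using ht)
  exact isNoetherianRing_of_ringEquiv _ (RingEquiv.quotientBot A)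

/-- Separated version of `isNoetherianRing_of_closed`: it suffices that finitely generated ideals
are closed up to the intersection of the powers of `m`. -/
theorem isNoetherianRing_quotient_iInf_pow {A : Type*} [CommRing A] {m : Ideal A} (hm : m.FG)
    [IsNoetherianRing (A ⧸ m)]
    (hclosed : ∀ J : Ideal A, J.FG → ⨅ k : ℕ, J ⊔ m ^ k ≤ J ⊔ ⨅ k : ℕ, m ^ k) :
    IsNoetherianRing (A ⧸ ⨅ k : ℕ, m ^ k) := by
  set N : Ideal A := ⨅ k : ℕ, m ^ k with hN
  have hsurj : Function.Surjective (Ideal.Quotient.mk N) := Ideal.Quotient.mk_surjective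
  have hcomap : ∀ K : Ideal A,
      (K.map (Ideal.Quotient.mk N)).comap (Ideal.Quotient.mk N) = K ⊔ N := fun K ↦ by
    rw [Ideal.comap_map_of_surjective _ hsurj, ← RingHom.ker_eq_comap_bot, Ideal.mk_ker]
  have hNm : N ≤ m := (iInf_le _ 1).trans (pow_one m).le
  have : IsNoetherianRing ((A ⧸ N) ⧸ m.map (Ideal.Quotient.mk N)) :=
    isNoetherianRing_of_ringEquiv _ (DoubleQuot.quotQuotEquivQuotOfLE hNm).symm
  refine isNoetherianRing_of_closed (m := m.map (Ideal.Quotient.mk N)) (hm.map _) fun L hL y hy ↦ ?_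
  obtain ⟨K, hK, hLK⟩ : ∃ K : Ideal A, K.FG ∧ K.map (Ideal.Quotient.mk N) = L := by
    classical
    obtain ⟨s, rfl⟩ := hL
    obtain ⟨t, -, rfl⟩ := Finset.subset_set_image_iff.mp
      (show (s : Set (A ⧸ N)) ⊆ Ideal.Quotient.mk N '' Set.univ by simp [hsurj.range_eq])
    exact ⟨Ideal.span t, ⟨t, rfl⟩, by rw [Ideal.map_span, Finset.coe_image]⟩
  subst hLK
  obtain ⟨a, rfl⟩ := hsurj y
  rw [← Ideal.mem_comap, hcomap]
  refine hclosed K hK ((Submodule.mem_iInf _).mpr fun k ↦ ?_)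
  have := (Submodule.mem_iInf _).mp hy k
  rwa [← Ideal.map_pow, ← Ideal.map_sup, ← Ideal.mem_comap, hcomap, sup_assoc,
    sup_eq_left.mpr (iInf_le _ k : N ≤ m ^ k)] at this

/-- A countably incomplete ultrafilter carries a function on `ℕ` tending to infinity along which
countably many properties, each holding almost everywhere, hold diagonally. -/
theorem Ultrafilter.exists_diagonal (u : Ultrafilter ℕ) (hu : ∀ a : ℕ, (u : Filter ℕ) ≠ pure a)
    (P : ℕ → ℕ → Prop) (hzero : ∀ w, P 0 w) (hP : ∀ k, ∀ᶠ w in (u : Filter ℕ), P k w) :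
    ∃ n : ℕ → ℕ, (∀ w, P (n w) w) ∧ ∀ k, ∀ᶠ w in (u : Filter ℕ), k ≤ n w := by
  classical
  have hcof : (u : Filter ℕ) ≤ atTop := by
    rw [← Nat.cofinite_eq_atTop]
    exact u.le_cofinite_or_eq_pure.resolve_right fun ⟨a, ha⟩ ↦ hu a (by rw [ha]; rfl)
  refine ⟨fun w ↦ Nat.findGreatest (P · w) w,
    fun w ↦ Nat.findGreatest_spec (P := (P · w)) (Nat.zero_le w) (hzero w), fun k ↦ ?_⟩
  filter_upwards [hP k, hcof (eventually_ge_atTop k)] with w hw hk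
  exact Nat.le_findGreatest hk hw

section Ultraproduct

variable (u : Ultrafilter ℕ) {R : ℕ → Type u} [∀ w, CommRing (R w)]

/-- The ideal of the ultraproduct given by a family of ideals. -/
def ultraproductIdeal (I : ∀ w, Ideal (R w)) : Ideal (Ultraproduct u R) :=
  Ideal.map (Ideal.Quotient.mk (ultraIdeal u R))
    { carrier := {f | ∀ᶠ w in (u : Filter ℕ), f w ∈ I w}
      zero_mem' := Eventually.of_forall fun w ↦ zero_mem (I w)
      add_mem' := fun ha hb ↦ by
        filter_upwards [ha, hb] with w h1 h2 using add_mem h1 h2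
      smul_mem' := fun c f hf ↦ by
        filter_upwards [hf] with w h using Ideal.mul_mem_left _ _ h }

variable {u}

theorem mk_mem_ultraproductIdeal {I : ∀ w, Ideal (R w)} {f : ∀ w, R w} :
    Ideal.Quotient.mk (ultraIdeal u R) f ∈ ultraproductIdeal u I ↔
      ∀ᶠ w in (u : Filter ℕ), f w ∈ I w := by
  refine Ideal.mem_quotient_iff_mem fun g hg ↦ ?_
  exact Eventually.mono hg fun w hw ↦ by simp [hw]

theorem mk_eq_mk_iff_eventually {f g : ∀ w, R w} :
    Ideal.Quotient.mk (ultraIdeal u R) f = Ideal.Quotient.mk (ultraIdeal u R) g ↔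
      ∀ᶠ w in (u : Filter ℕ), f w = g w := by
  rw [Ideal.Quotient.eq]
  exact eventually_congr (Eventually.of_forall fun w ↦ sub_eq_zero)

theorem isUnit_mk_iff_eventually {f : ∀ w, R w} :
    IsUnit (Ideal.Quotient.mk (ultraIdeal u R) f) ↔ ∀ᶠ w in (u : Filter ℕ), IsUnit (f w) := by
  classical
  constructor
  · intro h
    obtain ⟨y, hy⟩ := isUnit_iff_exists_inv.mp h
    obtain ⟨g, rfl⟩ := Ideal.Quotient.mk_surjective y
    rw [← map_mul, ← map_one (Ideal.Quotient.mk _), mk_eq_mk_iff_eventually] at hy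
    exact hy.mono fun w hw ↦ IsUnit.of_mul_eq_one _ hw
  · intro h
    refine IsUnit.of_mul_eq_one
      (Ideal.Quotient.mk _ fun w ↦ Ring.inverse (f w)) ?_
    rw [← map_mul, ← map_one (Ideal.Quotient.mk _), mk_eq_mk_iff_eventually]
    exact h.mono fun w hw ↦ Ring.mul_inverse_cancel _ hw

theorem ultraproductIdeal_mul_span_range {ι : Type*} [Fintype ι] (I : ∀ w, Ideal (R w))
    (x : ι → ∀ w, R w) :
    ultraproductIdeal u (fun w ↦ I w * Ideal.span (Set.range fun i ↦ x i w)) =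
      ultraproductIdeal u I * Ideal.span (Set.range fun i ↦ Ideal.Quotient.mk _ (x i)) := by
  classical
  apply le_antisymm
  · intro y hy
    obtain ⟨f, rfl⟩ := Ideal.Quotient.mk_surjective y
    rw [mk_mem_ultraproductIdeal] at hy
    have key : ∀ w, ∃ c : ι → R w, (∀ i, c i ∈ I w) ∧
        (f w ∈ I w * Ideal.span (Set.range fun i ↦ x i w) → ∑ i, c i * x i w = f w) := by
      intro w
      by_cases hw : f w ∈ I w * Ideal.span (Set.range fun i ↦ x i w)
      · obtain ⟨a, ha, hsum⟩ :=
          (Submodule.mem_ideal_smul_span_iff_exists_sum (I w) (fun i ↦ x i w) (f w)).mp hw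
        refine ⟨a, ha, fun _ ↦ ?_⟩
        rw [← hsum, Finsupp.sum_fintype _ _ (by simp)]
        rfl
      · exact ⟨0, fun i ↦ zero_mem _, fun h ↦ absurd h hw⟩
    choose c hc hcf using key
    have hf : Ideal.Quotient.mk (ultraIdeal u R) f =
        ∑ i, Ideal.Quotient.mk _ (fun w ↦ c w i) * Ideal.Quotient.mk _ (x i) := by
      simp only [← map_mul, ← map_sum]
      rw [mk_eq_mk_iff_eventually]
      filter_upwards [hy] with w hw
      simpa using (hcf w hw).symm
    rw [hf]
    exact sum_mem fun i _ ↦ Ideal.mul_mem_mul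
      (mk_mem_ultraproductIdeal.mpr (Eventually.of_forall fun w ↦ hc w i))
      (Ideal.subset_span ⟨i, rfl⟩)
  · rw [Ideal.mul_le]
    intro y hy z hz
    obtain ⟨f, rfl⟩ := Ideal.Quotient.mk_surjective y
    rw [mk_mem_ultraproductIdeal] at hy
    induction hz using Submodule.span_induction with
    | mem z hz =>
      obtain ⟨i, rfl⟩ := hz
      rw [← map_mul, mk_mem_ultraproductIdeal]
      filter_upwards [hy] with w hw
      exact Ideal.mul_mem_mul hw (Ideal.subset_span ⟨i, rfl⟩)
    | zero => simp
    | add a b _ _ ha hb => rw [mul_add]; exact add_mem ha hb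
    | smul a b _ hb => rw [smul_eq_mul, mul_left_comm]; exact Ideal.mul_mem_left _ _ hb

theorem ultraproductIdeal_top : ultraproductIdeal u (fun w ↦ (⊤ : Ideal (R w))) = ⊤ := by
  rw [Ideal.eq_top_iff_one, ← map_one (Ideal.Quotient.mk _), mk_mem_ultraproductIdeal]
  simp

theorem ultraproductIdeal_span_range {ι : Type*} [Fintype ι] (x : ι → ∀ w, R w) :
    ultraproductIdeal u (fun w ↦ Ideal.span (Set.range fun i ↦ x i w)) =
      Ideal.span (Set.range fun i ↦ Ideal.Quotient.mk _ (x i)) := by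
  simpa [ultraproductIdeal_top] using ultraproductIdeal_mul_span_range (u := u) (fun _ ↦ ⊤) x

theorem ultraproductIdeal_span_range_pow {ι : Type*} [Fintype ι] (x : ι → ∀ w, R w) (k : ℕ) :
    ultraproductIdeal u (fun w ↦ Ideal.span (Set.range fun i ↦ x i w) ^ k) =
      ultraproductIdeal u (fun w ↦ Ideal.span (Set.range fun i ↦ x i w)) ^ k := by
  induction k with
  | zero => simpa using ultraproductIdeal_top
  | succ k ih =>
    simp only [pow_succ, ultraproductIdeal_mul_span_range, ih, ultraproductIdeal_span_range]
    exact (pow_succ (Ideal.span (Set.range fun i ↦ Ideal.Quotient.mk (ultraIdeal u R) (x i))) k).symm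

theorem Ideal.exists_fin_span_range_eq {A : Type*} [CommRing A] {I : Ideal A} {s : Finset A}
    {e : ℕ} (hs : s.card ≤ e) (hI : Ideal.span (s : Set A) = I) :
    ∃ x : Fin e → A, Ideal.span (Set.range x) = I := by
  subst hI
  refine ⟨fun i ↦ if h : (i : ℕ) < s.card then s.equivFin.symm ⟨i, h⟩ else 0, le_antisymm ?_ ?_⟩
  · rw [Ideal.span_le]
    rintro _ ⟨i, rfl⟩
    dsimp only
    split_ifs
    · exact Ideal.subset_span (Subtype.coe_prop _)
    · exact zero_mem _
  · refine Ideal.span_mono fun a ha ↦ ?_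
    have hlt := (s.equivFin ⟨a, ha⟩).2
    exact ⟨⟨s.equivFin ⟨a, ha⟩, hlt.trans_le hs⟩, by simp⟩

theorem ultraproduct_isPrecomplete (hu : ∀ a : ℕ, (u : Filter ℕ) ≠ pure a)
    {I : ∀ w, Ideal (R w)}
    (hI : ∀ k : ℕ, ultraproductIdeal u (fun w ↦ I w ^ k) = ultraproductIdeal u I ^ k) :
    IsPrecomplete (ultraproductIdeal u I) (Ultraproduct u R) := by
  refine ⟨fun f hf ↦ ?_⟩
  simp only [smul_eq_mul, Ideal.mul_top, SModEq.sub_mem] at hf ⊢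
  choose a ha using fun n ↦ Ideal.Quotient.mk_surjective (f n)
  simp only [← ha, ← map_sub, ← hI, mk_mem_ultraproductIdeal] at hf ⊢
  obtain ⟨n, hn, hlim⟩ := u.exists_diagonal hu
    (fun k w ↦ ∀ i ≤ k, (a i - a k) w ∈ I w ^ i)
    (fun w i hi ↦ by simp [Nat.le_zero.mp hi])
    (fun k ↦ (eventually_all_finite (Set.finite_Iic k)).mpr fun i hi ↦ hf hi)
  refine ⟨Ideal.Quotient.mk _ fun w ↦ a (n w) w, fun k ↦ ?_⟩
  rw [← map_sub, mk_mem_ultraproductIdeal]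
  filter_upwards [hlim k] with w hw using hn w k hw

theorem ultraproduct_iInf_sup_pow_le (hu : ∀ a : ℕ, (u : Filter ℕ) ≠ pure a)
    {I : ∀ w, Ideal (R w)}
    (hI : ∀ k : ℕ, ultraproductIdeal u (fun w ↦ I w ^ k) = ultraproductIdeal u I ^ k)
    {J : Ideal (Ultraproduct u R)} (hJ : J.FG) :
    ⨅ k : ℕ, J ⊔ ultraproductIdeal u I ^ k ≤ J ⊔ ⨅ k : ℕ, ultraproductIdeal u I ^ k := by
  obtain ⟨r, y, rfl⟩ := Submodule.fg_iff_exists_fin_generating_family.mp hJ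
  choose x hx using fun i ↦ Ideal.Quotient.mk_surjective (y i)
  obtain rfl : (fun i ↦ Ideal.Quotient.mk (ultraIdeal u R) (x i)) = y := funext hx
  change ⨅ k : ℕ, Ideal.span _ ⊔ _ ≤ Ideal.span _ ⊔ _
  rw [← ultraproductIdeal_span_range]
  set K : ∀ w, Ideal (R w) := fun w ↦ Ideal.span (Set.range fun i ↦ x i w)
  intro z hz
  obtain ⟨a, rfl⟩ := Ideal.Quotient.mk_surjective z
  rw [Submodule.mem_iInf] at hz
  have hmem : ∀ k : ℕ, ∀ᶠ w in (u : Filter ℕ), a w ∈ K w ⊔ I w ^ k := by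
    intro k
    obtain ⟨s, hs, t, ht, hst⟩ := Submodule.mem_sup.mp (hz k)
    obtain ⟨s, rfl⟩ := Ideal.Quotient.mk_surjective s
    obtain ⟨t, rfl⟩ := Ideal.Quotient.mk_surjective t
    rw [← map_add, mk_eq_mk_iff_eventually] at hst
    rw [← hI, mk_mem_ultraproductIdeal] at ht
    rw [mk_mem_ultraproductIdeal] at hs
    filter_upwards [hs, ht, hst] with w h1 h2 h3
    exact h3 ▸ Submodule.add_mem_sup h1 h2
  obtain ⟨n, hn, hlim⟩ := u.exists_diagonal hu (fun k w ↦ a w ∈ K w ⊔ I w ^ k) (by simp) hmem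
  choose s hs t ht hst using fun w ↦ Submodule.mem_sup.mp (hn w)
  rw [show a = s + t from funext fun w ↦ (hst w).symm, map_add]
  refine Submodule.add_mem_sup (mk_mem_ultraproductIdeal.mpr (Eventually.of_forall hs))
    ((Submodule.mem_iInf _).mpr fun k ↦ ?_)
  rw [← hI, mk_mem_ultraproductIdeal]
  filter_upwards [hlim k] with w hw using Ideal.pow_le_pow_right hw (ht w)

variable [∀ w, IsLocalRing (R w)]

theorem ultraproduct_isLocalRing : IsLocalRing (Ultraproduct u R) := by
  have : Nontrivial (Ultraproduct u R) := Ideal.Quotient.nontrivial_iff.mpr fun h ↦ by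
    have h1 : ∀ᶠ w in (u : Filter ℕ), (1 : ∀ w, R w) w = 0 := (Ideal.eq_top_iff_one _).mp h
    simp [u.neBot.ne] at h1
  refine .of_isUnit_or_isUnit_one_sub_self fun y ↦ ?_
  obtain ⟨f, rfl⟩ := Ideal.Quotient.mk_surjective y
  rw [← map_one (Ideal.Quotient.mk _), ← map_sub, isUnit_mk_iff_eventually,
    isUnit_mk_iff_eventually, ← Ultrafilter.eventually_or]
  exact Eventually.of_forall fun w ↦ IsLocalRing.isUnit_or_isUnit_one_sub_self (f w)

theorem ultraproductIdeal_maximalIdeal [IsLocalRing (Ultraproduct u R)] :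
    ultraproductIdeal u (fun w ↦ IsLocalRing.maximalIdeal (R w)) =
      IsLocalRing.maximalIdeal (Ultraproduct u R) := by
  ext y
  obtain ⟨f, rfl⟩ := Ideal.Quotient.mk_surjective y
  simp only [mk_mem_ultraproductIdeal, IsLocalRing.mem_maximalIdeal, mem_nonunits_iff,
    isUnit_mk_iff_eventually, Ultrafilter.eventually_not]

end Ultraproduct

/-- For a precomplete ring, the quotient by the infinitesimals is the adic completion. -/
theorem exists_ringEquiv_adicCompletion {A : Type*} [CommRing A] (I : Ideal A)
    [IsPrecomplete I A] :
    ∃ φ : (A ⧸ ⨅ n : ℕ, I ^ n) ≃+* AdicCompletion I A,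
      ∀ x : A, φ (Ideal.Quotient.mk _ x) = algebraMap A (AdicCompletion I A) x := by
  have hsurj : Function.Surjective (algebraMap A (AdicCompletion I A)) :=
    AdicCompletion.of_surjective I A
  have hker : ⨅ n : ℕ, I ^ n = RingHom.ker (algebraMap A (AdicCompletion I A)) := by
    ext x
    rw [RingHom.mem_ker, AdicCompletion.algebraMap_apply, Submodule.mem_iInf,
      AdicCompletion.ext_iff]
    refine forall_congr' fun n ↦ ?_
    simp [Ideal.Quotient.eq_zero_iff_mem]
  exact ⟨(Ideal.quotEquivOfEq hker).trans (RingHom.quotientKerEquivOfSurjective hsurj),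
    fun x ↦ rfl⟩

set_option synthInstance.maxHeartbeats 1000000 in
set_option maxHeartbeats 2000000 in
theorem cataproduct_noetherian_complete
    (u : Ultrafilter ℕ) (hu : ∀ a : ℕ, (u : Filter ℕ) ≠ pure a)
    (R : ℕ → Type u) [∀ w, CommRing (R w)] [∀ w, IsLocalRing (R w)] (e : ℕ)
    (he : ∀ w, ∃ s : Finset (R w), s.card ≤ e ∧
      Ideal.span (s : Set (R w)) = IsLocalRing.maximalIdeal (R w)) :
    ∃ _h : IsLocalRing (Ultraproduct u R),
      Ideal.map (Ideal.Quotient.mk (ultraIdeal u R)) (ultraMaxPre u R)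
          = IsLocalRing.maximalIdeal (Ultraproduct u R) ∧
      IsNoetherianRing
        (Ultraproduct u R ⧸ (⨅ n : ℕ, IsLocalRing.maximalIdeal (Ultraproduct u R) ^ n)) ∧
      IsLocalRing
        (Ultraproduct u R ⧸ (⨅ n : ℕ, IsLocalRing.maximalIdeal (Ultraproduct u R) ^ n)) ∧
      ∃ φ : (Ultraproduct u R ⧸ (⨅ n : ℕ, IsLocalRing.maximalIdeal (Ultraproduct u R) ^ n))
            ≃+* AdicCompletion (IsLocalRing.maximalIdeal (Ultraproduct u R)) (Ultraproduct u R),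
        ∀ x : Ultraproduct u R,
          φ (Ideal.Quotient.mk _ x)
            = algebraMap (Ultraproduct u R)
                (AdicCompletion (IsLocalRing.maximalIdeal (Ultraproduct u R)) (Ultraproduct u R)) x := by
  choose s hs hspan using he
  choose x hx using fun w ↦ Ideal.exists_fin_span_range_eq (hs w) (hspan w)
  have hloc : IsLocalRing (Ultraproduct u R) := ultraproduct_isLocalRing
  have hmax := ultraproductIdeal_maximalIdeal (u := u) (R := R)
  have hpow (k : ℕ) : ultraproductIdeal u (fun w ↦ IsLocalRing.maximalIdeal (R w) ^ k) =
      ultraproductIdeal u (fun w ↦ IsLocalRing.maximalIdeal (R w)) ^ k := by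
    simpa only [hx] using ultraproductIdeal_span_range_pow (u := u) (fun i w ↦ x w i) k
  have hfg : (IsLocalRing.maximalIdeal (Ultraproduct u R)).FG := by
    have hgen := ultraproductIdeal_span_range (u := u) (fun i w ↦ x w i)
    simp only [hx, hmax] at hgen
    exact Submodule.fg_iff_exists_fin_generating_family.mpr ⟨e, _, hgen.symm⟩
  have hclosed (J : Ideal (Ultraproduct u R)) (hJ : J.FG) :=
    ultraproduct_iInf_sup_pow_le hu hpow hJ
  have hprec := ultraproduct_isPrecomplete hu hpow
  rw [hmax] at hprec
  simp only [hmax] at hclosed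
  have hfield : IsNoetherianRing
      (Ultraproduct u R ⧸ IsLocalRing.maximalIdeal (Ultraproduct u R)) :=
    inferInstanceAs (IsNoetherianRing (IsLocalRing.ResidueField (Ultraproduct u R)))
  have hne : Nontrivial
      (Ultraproduct u R ⧸ ⨅ n : ℕ, IsLocalRing.maximalIdeal (Ultraproduct u R) ^ n) :=
    Ideal.Quotient.nontrivial_iff.mpr <| ne_top_of_le_ne_top
      (IsLocalRing.maximalIdeal.isMaximal (Ultraproduct u R)).ne_top
      ((iInf_le _ 1).trans (Ideal.pow_le_self one_ne_zero))
  exact ⟨hloc, hmax, isNoetherianRing_quotient_iInf_pow hfg hclosed,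
    .of_surjective' _ Ideal.Quotient.mk_surjective, exists_ringEquiv_adicCompletion _⟩
end
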